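/- Let X be a separable real Banach space and let f : X → ℝ be quasiconvex and densely continuous. Then the set of points at which f is both continuous and essentially Gâteaux differentiable is dense in X. If moreover X is reflexive, then the set of points at which f fails to be continuous or fails to be essentially Gâteaux differentiable is contained in a Haar null set. -/

import Mathlib

open Filter Topology Set MeasureTheory

/-- `f` is quasiconvex: `f (l•x + (1-l)•y) ≤ max (f x) (f y)` for `l ∈ [0,1]`. -/
def QuasiconvexFun {X : Type*} [AddCommGroup X] [Module ℝ X] (f : X → ℝ) : Prop :=
  ∀ x y : X, ∀ l : ℝ, l ∈ Set.Icc (0 : ℝ) 1 →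
    f (l • x + (1 - l) • y) ≤ max (f x) (f y)

/-- `f` is strictly quasiconvex. -/
def StrictlyQuasiconvexFun {X : Type*} [AddCommGroup X] [Module ℝ X] (f : X → ℝ) : Prop :=
  ∀ x y : X, x ≠ y → ∀ l : ℝ, l ∈ Set.Ioo (0 : ℝ) 1 →
    f (l • x + (1 - l) • y) < max (f x) (f y)

/-- `f` is densely continuous: its set of points of continuity is dense. -/
def DenselyContinuous {X : Type*} [TopologicalSpace X] (f : X → ℝ) : Prop :=
  Dense {x : X | ContinuousAt f x}

/-- `m` is the topological essential infimum of `f`: the strict sublevel set `{f < α}`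
is meager for `α < m` and nonmeager for `α > m`. -/
def IsTopEssInf {X : Type*} [TopologicalSpace X] (f : X → ℝ) (m : ℝ) : Prop :=
  (∀ α : ℝ, α < m → IsMeagre {x : X | f x < α}) ∧
  (∀ α : ℝ, m < α → ¬ IsMeagre {x : X | f x < α})

/-- Aronszajn null set: a Borel set `N` such that for every sequence `ξ` with dense linear
span, `N` decomposes as a countable union of Borel sets, the `n`-th of which has Lebesgue
null intersection with every line of direction `ξ n`. -/
def AronszajnNull {X : Type*} [NormedAddCommGroup X] [NormedSpace ℝ X]
    [MeasurableSpace X] (N : Set X) : Prop :=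
  MeasurableSet N ∧
  ∀ ξ : ℕ → X, Dense (Submodule.span ℝ (Set.range ξ) : Set X) →
    ∃ Nn : ℕ → Set X, N = ⋃ n, Nn n ∧
      ∀ n, MeasurableSet (Nn n) ∧
        ∀ x : X, MeasureTheory.volume {t : ℝ | x + t • ξ n ∈ Nn n} = 0

/-- Haar null set: `E` is contained in a Borel set `B` for which there is a Borel
probability measure vanishing on all translates of `B`. -/
def HaarNull {X : Type*} [AddCommGroup X] [TopologicalSpace X]
    [MeasurableSpace X] (E : Set X) : Prop :=
  ∃ B : Set X, E ⊆ B ∧ MeasurableSet B ∧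
    ∃ μ : MeasureTheory.Measure X, MeasureTheory.IsProbabilityMeasure μ ∧
      ∀ x : X, μ ((fun y => x + y) '' B) = 0

/-- Hadamard differentiability of `f` at `x`. -/
def HadamardDiffAt {X : Type*} [NormedAddCommGroup X] [NormedSpace ℝ X]
    (f : X → ℝ) (x : X) : Prop :=
  ∃ L : X →L[ℝ] ℝ, ∀ h : X, ∀ t : ℕ → ℝ, (∀ n, t n ≠ 0) →
    Tendsto t atTop (𝓝 0) → ∀ hs : ℕ → X, Tendsto hs atTop (𝓝 h) →
      Tendsto (fun n => (f (x + t n • hs n) - f x) / t n) atTop (𝓝 (L h))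

/-- Hadamard differentiability at `x` of a function whose relevant values are those on `V`. -/
def HadamardDiffWithinAt {X : Type*} [NormedAddCommGroup X] [NormedSpace ℝ X]
    (f : X → ℝ) (V : Set X) (x : X) : Prop :=
  ∃ L : X →L[ℝ] ℝ, ∀ h : X, ∀ t : ℕ → ℝ, (∀ n, t n ≠ 0) →
    Tendsto t atTop (𝓝 0) → ∀ hs : ℕ → X, Tendsto hs atTop (𝓝 h) →
      (∀ n, x + t n • hs n ∈ V) →
      Tendsto (fun n => (f (x + t n • hs n) - f x) / t n) atTop (𝓝 (L h))

/-- Gâteaux differentiability of `f` at `x` with derivative `L`. -/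
def GateauxDiffAt {X : Type*} [NormedAddCommGroup X] [NormedSpace ℝ X]
    (f : X → ℝ) (x : X) (L : X →L[ℝ] ℝ) : Prop :=
  ∀ h : X, Tendsto (fun t : ℝ => (f (x + t • h) - f x) / t) (𝓝[≠] 0) (𝓝 (L h))

/-- Essential Gâteaux differentiability of `f` at `x`: directional derivatives exist and
are given by a continuous linear functional for a comeager (residual) set of directions
in the unit sphere. -/
def EssGateauxDiffAt {X : Type*} [NormedAddCommGroup X] [NormedSpace ℝ X]
    (f : X → ℝ) (x : X) : Prop :=
  ∃ L : X →L[ℝ] ℝ, ∃ Ω : Set (Metric.sphere (0 : X) 1), IsMeagre Ωᶜ ∧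
    ∀ h ∈ Ω, Tendsto (fun t : ℝ => (f (x + t • (h : X)) - f x) / t) (𝓝[≠] 0) (𝓝 (L (h : X)))

/-- `K` is a closed convex cone. -/
def IsClosedConvexCone {X : Type*} [NormedAddCommGroup X] [NormedSpace ℝ X] (K : Set X) : Prop :=
  IsClosed K ∧ Convex ℝ K ∧ ∀ l : ℝ, 0 ≤ l → ∀ k ∈ K, l • k ∈ K

/-- `f` is `K`-nondecreasing on `U`. -/
def KNondecreasingOn {X : Type*} [AddCommGroup X] [Module ℝ X]
    (f : X → ℝ) (K U : Set X) : Prop :=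
  ∀ u ∈ U, ∀ k ∈ K, k ≠ 0 → u + k ∈ U → f u ≤ f (u + k)

/-- Ideally convex subset: stable under infinite convex combinations of bounded sequences. -/
def IdeallyConvex {X : Type*} [NormedAddCommGroup X] [NormedSpace ℝ X] (C : Set X) : Prop :=
  ∀ (x : ℕ → X) (lam : ℕ → ℝ), (∀ n, x n ∈ C) → Bornology.IsBounded (Set.range x) →
    (∀ n, lam n ∈ Set.Icc (0 : ℝ) 1) → HasSum lam 1 →
      ∑' n, lam n • x n ∈ C

/-- `C‡`: the union, over finite dimensional subspaces `Z ⊆ X`, of the closures of `C ∩ Z`. -/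
def Ddag {X : Type*} [NormedAddCommGroup X] [NormedSpace ℝ X] (C : Set X) : Set X :=
  ⋃ (Z : Submodule ℝ X) (_ : FiniteDimensional ℝ Z), closure (C ∩ (Z : Set X))

/-- A normed space is reflexive if the canonical inclusion into its double dual is onto. -/
def IsReflexiveSpace (X : Type*) [NormedAddCommGroup X] [NormedSpace ℝ X] : Prop :=
  Function.Surjective (NormedSpace.inclusionInDoubleDual ℝ X)

set_option linter.unusedSectionVars false
set_option linter.unusedSimpArgs false


/-- Every scale carries a probability measure giving small mass to all translates of `B`. -/
def SmallNull {X : Type*} [NormedAddCommGroup X] [MeasurableSpace X] (B : Set X) : Prop :=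
  ∀ r : ℝ, 0 < r → ∀ δ : ENNReal, 0 < δ → ∃ μ : Measure X, IsProbabilityMeasure μ ∧
    μ (Metric.closedBall 0 r)ᶜ = 0 ∧ ∀ x : X, μ {y | x + y ∈ B} ≤ δ

section combine
variable {X : Type*} [NormedAddCommGroup X] [NormedSpace ℝ X] [CompleteSpace X]
    [TopologicalSpace.SeparableSpace X] [MeasurableSpace X] [BorelSpace X]

open Classical in
/-- truncation -/
noncomputable def truncB (X : Type*) [NormedAddCommGroup X] (j : ℕ) (x : X) : X :=
  if x ∈ Metric.closedBall (0 : X) ((1/2)^j) then x else 0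

lemma truncB_measurable (j : ℕ) : Measurable (truncB X j) := by
  unfold truncB
  exact Measurable.ite Metric.isClosed_closedBall.measurableSet measurable_id measurable_const

lemma truncB_norm (j : ℕ) (x : X) : ‖truncB X j x‖ ≤ (1/2)^j := by
  unfold truncB
  split_ifs with h
  · simpa using h
  · simp

/-- random series -/
noncomputable def serB (X : Type*) [NormedAddCommGroup X] (ω : ℕ → X) : X :=
  ∑' j, truncB X j (ω j)

lemma serB_summable (ω : ℕ → X) : Summable (fun j => truncB X j (ω j)) := by
  refine Summable.of_norm_bounded (g := fun j => (1/2 : ℝ)^j) ?_ (fun j => truncB_norm j _)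
  exact summable_geometric_of_lt_one (by norm_num) (by norm_num)

lemma serB_measurable : Measurable (serB X) := by
  have : SecondCountableTopology X := UniformSpace.secondCountable_of_separable X
  have h : ∀ n : ℕ, Measurable (fun ω : ℕ → X => ∑ j ∈ Finset.range n, truncB X j (ω j)) := by
    intro n
    exact Finset.measurable_sum _ (fun j _ => (truncB_measurable j).comp (measurable_pi_apply j))
  refine measurable_of_tendsto_metrizable h ?_
  rw [tendsto_pi_nhds]
  intro ω
  exact (serB_summable ω).hasSum.tendsto_sum_nat

lemma serB_update (ω : ℕ → X) (j : ℕ) (y : X) :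
    serB X (Function.update ω j y) = serB X (Function.update ω j 0) + truncB X j y := by
  have h0 : truncB X j (0:X) = 0 := by unfold truncB; split_ifs <;> rfl
  have h1 := serB_summable (Function.update ω j y)
  have h2 := serB_summable (Function.update ω j 0)
  unfold serB
  rw [h1.tsum_eq_add_tsum_ite j, h2.tsum_eq_add_tsum_ite j]
  simp only [Function.update_self, h0, zero_add]
  rw [add_comm]
  congr 2
  ext k
  by_cases hk : k = j
  · simp [hk]
  · simp [hk]

lemma infinitePi_update {Y : Type*} [MeasurableSpace Y] (μ : ℕ → Measure Y) [∀ i, IsProbabilityMeasure (μ i)] (j : ℕ) :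
    ((Measure.infinitePi μ).prod (μ j)).map (fun p : (ℕ → Y) × Y => Function.update p.1 j p.2)
      = Measure.infinitePi μ := by
  have hm : Measurable (fun p : (ℕ → Y) × Y => Function.update p.1 j p.2) := by
    rw [measurable_pi_iff]
    intro k
    by_cases hk : k = j
    · subst hk; simpa using measurable_snd
    · simp only [Function.update_of_ne hk]
      exact (measurable_pi_apply k).comp measurable_fst
  apply Measure.eq_infinitePi
  intro s t ht
  rw [Measure.map_apply hm (MeasurableSet.pi s.countable_toSet (fun i _ => ht i))]
  by_cases hj : j ∈ s
  · have : (fun p : (ℕ → Y) × Y => Function.update p.1 j p.2) ⁻¹' (Set.pi s t)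
        = (Set.pi (s.erase j : Finset ℕ) t) ×ˢ (t j) := by
      ext p
      simp only [mem_preimage, Set.mem_pi, mem_prod, Finset.mem_coe, Finset.mem_erase]
      constructor
      · intro h
        refine ⟨fun i hi => ?_, ?_⟩
        · have := h i hi.2
          rwa [Function.update_of_ne hi.1] at this
        · simpa using h j hj
      · rintro ⟨h1, h2⟩ i hi
        by_cases hij : i = j
        · subst hij; simpa using h2
        · rw [Function.update_of_ne hij]; exact h1 i ⟨hij, hi⟩
    rw [this, Measure.prod_prod, Measure.infinitePi_pi _ (fun i _ => ht i), Finset.prod_erase_mul s _ hj]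
  · have : (fun p : (ℕ → Y) × Y => Function.update p.1 j p.2) ⁻¹' (Set.pi s t)
        = (Set.pi s t) ×ˢ univ := by
      ext p
      simp only [mem_preimage, Set.mem_pi, mem_prod, Finset.mem_coe, mem_univ, and_true]
      refine forall₂_congr fun i hi => ?_
      have : i ≠ j := fun h => hj (h ▸ hi)
      rw [Function.update_of_ne this]
    rw [this, Measure.prod_prod, Measure.infinitePi_pi _ (fun i _ => ht i), measure_univ, mul_one]

theorem combine_smallNull (B : ℕ → Set X) (hB : ∀ n, MeasurableSet (B n)) (hs : ∀ n, SmallNull (B n)) :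
    ∃ μ : Measure X, IsProbabilityMeasure μ ∧ ∀ x : X, μ ((fun y => x + y) '' (⋃ n, B n)) = 0 := by
  have : SecondCountableTopology X := UniformSpace.secondCountable_of_separable X
  have key : ∀ j : ℕ, ∃ μ : Measure X, IsProbabilityMeasure μ ∧
      μ (Metric.closedBall 0 ((1/2)^j))ᶜ = 0 ∧
      ∀ x : X, μ {y | x + y ∈ B (Nat.unpair j).1} ≤ ((Nat.unpair j).2 + 1 : ENNReal)⁻¹ := by
    intro j
    refine hs _ _ (by positivity) _ ?_
    rw [ENNReal.inv_pos]
    exact ENNReal.add_ne_top.2 ⟨ENNReal.natCast_ne_top _, ENNReal.one_ne_top⟩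
  choose μ hμp hμb hμs using key
  have hPm := serB_measurable (X := X)
  refine ⟨(Measure.infinitePi μ).map (serB X), Measure.isProbabilityMeasure_map hPm.aemeasurable, ?_⟩
  have main : ∀ (x : X) (n : ℕ), (Measure.infinitePi μ).map (serB X) {y | x + y ∈ B n} = 0 := by
    intro x n
    have hme : MeasurableSet {y | x + y ∈ B n} := (measurable_const_add x) (hB n)
    have bound : ∀ k : ℕ, (Measure.infinitePi μ).map (serB X) {y | x + y ∈ B n} ≤ (k + 1 : ENNReal)⁻¹ := by
      intro k
      set j := Nat.pair n k with hj
      rw [Measure.map_apply hPm hme, ← infinitePi_update μ j]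
      have hu : Measurable (fun p : (ℕ → X) × X => Function.update p.1 j p.2) := by
        rw [measurable_pi_iff]
        intro k
        by_cases hk : k = j
        · subst hk; simpa using measurable_snd
        · simp only [Function.update_of_ne hk]
          exact (measurable_pi_apply k).comp measurable_fst
      rw [Measure.map_apply hu (hPm hme), Measure.prod_apply (hu (hPm hme))]
      have : ∀ ω : ℕ → X, (μ j) (Prod.mk ω ⁻¹' ((fun p : (ℕ → X) × X => Function.update p.1 j p.2) ⁻¹'
          (serB X ⁻¹' {y | x + y ∈ B n}))) ≤ (k + 1 : ENNReal)⁻¹ := by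
        intro ω
        have hb := hμs j (x + serB X (Function.update ω j 0))
        rw [hj, Nat.unpair_pair] at hb
        refine le_trans ?_ hb
        rw [← hj]
        refine measure_mono_ae ?_
        have : ∀ᵐ y ∂(μ j), y ∈ Metric.closedBall (0:X) ((1/2)^j) := by
          rw [ae_iff]; exact hμb j
        filter_upwards [this] with y hy hmem
        have hmem' : x + serB X (Function.update ω j y) ∈ B n := hmem
        rw [serB_update] at hmem'
        have ht : truncB X j y = y := by unfold truncB; rw [if_pos hy]
        rw [ht, ← add_assoc] at hmem'
        exact hmem'
      calc _ ≤ ∫⁻ _ω, (k + 1 : ENNReal)⁻¹ ∂(Measure.infinitePi μ) := lintegral_mono this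
        _ = _ := by simp
    refine le_antisymm ?_ (zero_le)
    refine ge_of_tendsto' (x := atTop) (f := fun k : ℕ => ((k:ENNReal) + 1)⁻¹) ?_ bound
    have := ENNReal.tendsto_inv_nat_nhds_zero
    have h2 := (tendsto_add_atTop_iff_nat 1).2 this
    simpa using h2
  intro x
  rw [Set.image_iUnion]
  refine measure_iUnion_null (fun n => ?_)
  have : (fun y => x + y) '' B n = {y | -x + y ∈ B n} := by
    ext y; simp [Set.mem_image]
  rw [this]
  exact main (-x) n

/-- finite dimensional nullity -/
def FinDimNull (B : Set X) : Prop :=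
  ∃ (n : ℕ) (φ : (Fin n → ℝ) →L[ℝ] X), ∀ x : X, volume {t : Fin n → ℝ | x + φ t ∈ B} = 0

theorem FinDimNull.smallNull {B : Set X} (hB : MeasurableSet B) (h : FinDimNull B) : SmallNull B := by
  obtain ⟨n, φ, hφ⟩ := h
  intro r hr δ hδ
  obtain ⟨s, hs, hsr⟩ : ∃ s > 0, ∀ t ∈ Metric.ball (0 : Fin n → ℝ) s, φ t ∈ Metric.closedBall 0 r := by
    have := φ.continuous.continuousAt.preimage_mem_nhds (t := Metric.closedBall 0 r) (x := 0)
      (by simpa using Metric.closedBall_mem_nhds (0:X) hr)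
    obtain ⟨s, hs, hh⟩ := Metric.mem_nhds_iff.1 this
    exact ⟨s, hs, fun t ht => hh ht⟩
  have hpos : volume (Metric.ball (0 : Fin n → ℝ) s) ≠ 0 := (Metric.measure_ball_pos _ _ hs).ne'
  have hfin : volume (Metric.ball (0 : Fin n → ℝ) s) ≠ ⊤ := measure_ball_lt_top.ne
  set ν := ProbabilityTheory.cond (volume : Measure (Fin n → ℝ)) (Metric.ball 0 s) with hν
  have : IsProbabilityMeasure ν := ProbabilityTheory.cond_isProbabilityMeasure_of_finite hpos hfin
  have hac : ν ≪ volume := ProbabilityTheory.cond_absolutelyContinuous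
  refine ⟨ν.map φ, Measure.isProbabilityMeasure_map φ.continuous.aemeasurable, ?_, ?_⟩
  · rw [Measure.map_apply φ.continuous.measurable Metric.isClosed_closedBall.measurableSet.compl]
    rw [hν, ProbabilityTheory.cond_apply Metric.isOpen_ball.measurableSet]
    have : Metric.ball (0 : Fin n → ℝ) s ∩ φ ⁻¹' (Metric.closedBall 0 r)ᶜ = ∅ := by
      ext t
      simp only [mem_inter_iff, mem_preimage, mem_compl_iff, mem_empty_iff_false, iff_false, not_and, not_not]
      exact hsr t
    rw [this]; simp
  · intro x
    rw [Measure.map_apply φ.continuous.measurable]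
    · have := hac (hφ x)
      exact le_trans (le_of_eq this) (zero_le)
    · exact ((continuous_const_add x).measurable) hB

/-- line nullity -/
theorem finDimNull_of_line {B : Set X} (v : X) (h : ∀ x : X, {t : ℝ | x + t • v ∈ B}.Subsingleton) :
    FinDimNull B := by
  refine ⟨1, (ContinuousLinearMap.proj (R := ℝ) (φ := fun _ : Fin 1 => ℝ) 0).smulRight v, fun x => ?_⟩
  have : {t : Fin 1 → ℝ | x + ((ContinuousLinearMap.proj (R := ℝ) (φ := fun _ : Fin 1 => ℝ) 0).smulRight v) t ∈ B}.Subsingleton := by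
    intro s hs t ht
    have : s 0 = t 0 := (h x) hs ht
    ext i
    rw [Subsingleton.elim i 0]; exact this
  exact this.measure_zero _

theorem SmallNull.not_open {B U : Set X}
    (h : ∃ μ : Measure X, IsProbabilityMeasure μ ∧ ∀ x : X, μ ((fun y => x + y) '' B) = 0)
    (hU : IsOpen U) (hne : U.Nonempty) : ∃ u ∈ U, u ∉ B := by
  by_contra! hc
  obtain ⟨μ, hμ, h0⟩ := h
  obtain ⟨u, hu⟩ := hne
  have hcov : (⋃ n : ℕ, (fun y => (TopologicalSpace.denseSeq X n - u) + y) '' B) = univ := by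
    rw [eq_univ_iff_forall]
    intro x
    have ho : IsOpen ((fun d => x - d + u) ⁻¹' U) := hU.preimage (by fun_prop)
    obtain ⟨d, hd2⟩ := (TopologicalSpace.denseRange_denseSeq X).exists_mem_open ho ⟨x, by simpa using hu⟩
    rw [mem_iUnion]
    refine ⟨d, x - TopologicalSpace.denseSeq X d + u, hc _ hd2, by simp⟩
  have : μ univ = 0 := by
    rw [← hcov]
    exact measure_iUnion_null (fun n => h0 _)
  simp at this
end combine


section cone
variable {X : Type*} [NormedAddCommGroup X] [NormedSpace ℝ X]

/-- bounded and monotone along a cone of directions around `v` -/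
structure ConeMono (g : X → ℝ) (v : X) (ρ M : ℝ) : Prop where
  pos : 0 < ρ
  bdd : ∀ y, |g y| ≤ M
  mono : ∀ y, ∀ w ∈ Metric.ball v ρ, ∀ s : ℝ, 0 ≤ s → g y ≤ g (y + s • w)

/-- the auxiliary Lipschitz function -/
noncomputable def Gf (g : X → ℝ) (v : X) (z : X) : ℝ := sSup {s : ℝ | g (z + s • v) + s ≤ 0}

/-- the Lipschitz inverse -/
noncomputable def Psi (g : X → ℝ) (v : X) (z : X) : X := z + Gf g v z • v

variable {g : X → ℝ} {v : X} {ρ M : ℝ}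

namespace ConeMono

lemma mono_v (h : ConeMono g v ρ M) (y : X) {s t : ℝ} (hst : s ≤ t) : g (y + s • v) ≤ g (y + t • v) := by
  have := h.mono (y + s • v) v (Metric.mem_ball_self h.pos) (t - s) (by linarith)
  rwa [add_assoc, ← add_smul, add_sub_cancel] at this

lemma bddAbove (h : ConeMono g v ρ M) (z : X) : BddAbove {s : ℝ | g (z + s • v) + s ≤ 0} := by
  refine ⟨M, fun s hs => ?_⟩
  have := abs_le.1 (h.bdd (z + s • v))
  simp only [mem_setOf_eq] at hs
  linarith [this.1]

lemma nonempty (h : ConeMono g v ρ M) (z : X) : {s : ℝ | g (z + s • v) + s ≤ 0}.Nonempty := by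
  refine ⟨-M, ?_⟩
  have := abs_le.1 (h.bdd (z + (-M) • v))
  simp only [mem_setOf_eq]
  linarith [this.2]

lemma le_G (h : ConeMono g v ρ M) {z : X} {s : ℝ} (hs : g (z + s • v) + s ≤ 0) : s ≤ Gf g v z :=
  le_csSup (h.bddAbove z) hs

lemma of_lt_G (h : ConeMono g v ρ M) {z : X} {s : ℝ} (hs : s < Gf g v z) : g (z + s • v) + s ≤ 0 := by
  obtain ⟨s', hs', hlt⟩ := exists_lt_of_lt_csSup (h.nonempty z) hs
  have := h.mono_v z hlt.le
  simp only [mem_setOf_eq] at hs'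
  linarith

lemma of_G_lt (h : ConeMono g v ρ M) {z : X} {s : ℝ} (hs : Gf g v z < s) : 0 < g (z + s • v) + s := by
  by_contra hc
  exact absurd (h.le_G (not_lt.1 hc)) (not_le.2 hs)

lemma G_eq (h : ConeMono g v ρ M) {z : X} {s : ℝ} (hs : g (z + s • v) + s = 0) : Gf g v z = s := by
  refine le_antisymm ?_ (h.le_G hs.le)
  by_contra hc
  push Not at hc
  obtain ⟨s', hs', hlt⟩ := exists_lt_of_lt_csSup (h.nonempty z) hc
  have := h.mono_v z hlt.le
  simp only [mem_setOf_eq] at hs'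
  linarith

lemma G_Phi (h : ConeMono g v ρ M) (y : X) : Gf g v (y + g y • v) = - g y := by
  apply h.G_eq
  simp [add_assoc]

lemma Psi_Phi (h : ConeMono g v ρ M) (y : X) : Psi g v (y + g y • v) = y := by
  unfold Psi
  rw [h.G_Phi]
  simp [add_assoc]

lemma G_shift (h : ConeMono g v ρ M) (z u : X) {τ : ℝ} (hτ : 0 < τ) (hu : ‖u‖ < ρ * τ) :
    Gf g v z - τ ≤ Gf g v (z + u) := by
  rw [sub_le_iff_le_add]
  refine csSup_le (h.nonempty z) fun s hs => ?_
  rw [← sub_le_iff_le_add]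
  apply h.le_G
  have hw : v - τ⁻¹ • u ∈ Metric.ball v ρ := by
    rw [Metric.mem_ball, dist_eq_norm]
    have : v - τ⁻¹ • u - v = -(τ⁻¹ • u) := by abel
    rw [this, norm_neg, norm_smul, Real.norm_eq_abs, abs_of_pos (inv_pos.2 hτ)]
    rw [inv_mul_lt_iff₀ hτ]; linarith [mul_comm ρ τ]
  have := h.mono (z + u + (s - τ) • v) _ hw τ hτ.le
  have e : z + u + (s - τ) • v + τ • (v - τ⁻¹ • u) = z + s • v := by
    rw [smul_sub, smul_smul, mul_inv_cancel₀ hτ.ne', one_smul, sub_smul]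
    abel
  rw [e] at this
  simp only [mem_setOf_eq] at hs
  linarith

lemma G_lip (h : ConeMono g v ρ M) : LipschitzWith (Real.toNNReal ρ⁻¹) (Gf g v) := by
  have key : ∀ z u : X, Gf g v z - ρ⁻¹ * ‖u‖ ≤ Gf g v (z + u) := by
    intro z u
    refine le_of_forall_pos_le_add fun ε hε => ?_
    have := h.G_shift z u (τ := ρ⁻¹ * ‖u‖ + ε) (by have := h.pos; positivity) (by
      have := h.pos
      rw [mul_add, mul_inv_cancel_left₀ this.ne']
      have : 0 < ρ * ε := by positivity
      linarith)
    linarith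
  refine LipschitzWith.of_dist_le_mul fun x y => ?_
  rw [Real.coe_toNNReal _ (inv_pos.2 h.pos).le, Real.dist_eq, dist_eq_norm, abs_le]
  have h1 := key x (y - x)
  have h2 := key y (x - y)
  rw [add_sub_cancel] at h1 h2
  rw [norm_sub_rev] at h1
  constructor <;> linarith

lemma G_mono (h : ConeMono g v ρ M) (z : X) {s t : ℝ} (hst : s ≤ t) :
    s + Gf g v (z + s • v) ≤ t + Gf g v (z + t • v) := by
  have : Gf g v (z + s • v) ≤ (t - s) + Gf g v (z + t • v) := by
    refine csSup_le (h.nonempty _) fun r hr => ?_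
    rw [← sub_le_iff_le_add']
    apply h.le_G
    have e : z + t • v + (r - (t - s)) • v = z + s • v + r • v := by
      rw [add_assoc, add_assoc, ← add_smul, ← add_smul]; congr 2; ring
    rw [e]
    simp only [mem_setOf_eq] at hr
    linarith
  linarith

/-- regular points of `G` are points of strict increase -/
lemma strict_of_deriv (h : ConeMono g v ρ M) {z : X} (hd : LineDifferentiableAt ℝ (Gf g v) z v)
    (hne : lineDeriv ℝ (Gf g v) z v ≠ -1) {t : ℝ} (ht : t ≠ 0) :
    t + Gf g v (z + t • v) ≠ Gf g v z := by
  intro he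
  apply hne
  have hder : HasDerivAt (fun t : ℝ => Gf g v (z + t • v)) (lineDeriv ℝ (Gf g v) z v) 0 := hd.hasLineDerivAt
  have hconst : ∀ s ∈ uIcc 0 t, Gf g v (z + s • v) = Gf g v z - s := by
    intro s hs
    rcases le_total 0 t with h0 | h0
    · rw [uIcc_of_le h0] at hs
      have h1 := h.G_mono z hs.1
      have h2 := h.G_mono z hs.2
      simp only [zero_smul, add_zero, zero_add] at h1
      linarith
    · rw [uIcc_of_ge h0] at hs
      have h1 := h.G_mono z hs.1
      have h2 := h.G_mono z hs.2
      simp only [zero_smul, add_zero, zero_add] at h2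
      linarith
  have hder2 : HasDerivWithinAt (fun t : ℝ => Gf g v (z + t • v)) (-1) (uIcc 0 t) 0 := by
    have : HasDerivWithinAt (fun s : ℝ => Gf g v z - s) (-1) (uIcc 0 t) 0 := by
      simpa using ((hasDerivAt_id (0:ℝ)).const_sub (Gf g v z)).hasDerivWithinAt
    exact this.congr hconst (hconst 0 left_mem_uIcc)
  have hu : UniqueDiffWithinAt ℝ (uIcc 0 t) 0 :=
    uniqueDiffOn_Icc (by simpa [inf_lt_sup] using ht) 0 left_mem_uIcc
  exact hu.eq_deriv _ hder.hasDerivWithinAt hder2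

lemma Psi_inj (h : ConeMono g v ρ M) (hv : v ≠ 0) {z z' : X} (hd : LineDifferentiableAt ℝ (Gf g v) z v)
    (hne : lineDeriv ℝ (Gf g v) z v ≠ -1) (he : Psi g v z = Psi g v z') : z' = z := by
  unfold Psi at he
  set t := Gf g v z - Gf g v z' with ht
  have hz : z' = z + t • v := by
    rw [ht, sub_smul, ← add_sub_assoc, he]; abel
  by_cases h0 : t = 0
  · rw [hz, h0]; simp
  · exfalso
    apply h.strict_of_deriv hd hne h0
    rw [← hz, ht]; ring

lemma continuousAt (h : ConeMono g v ρ M) {z : X} (hd : LineDifferentiableAt ℝ (Gf g v) z v)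
    (hne : lineDeriv ℝ (Gf g v) z v ≠ -1) (hv : v ≠ 0) : ContinuousAt g (Psi g v z) := by
  set y := Psi g v z with hy
  have hz : y + g y • v = z := h.Psi_inj hv hd hne (by rw [h.Psi_Phi])
  have hGz : Gf g v z = - g y := by rw [← hz]; exact h.G_Phi y
  rw [Metric.continuousAt_iff]
  intro ε hε
  -- upper
  have up : ∃ η : ℝ, 0 < η ∧ g (y + η • v) ≤ g y + ε / 2 := by
    have h1 := h.G_mono z (s := 0) (t := ε/2) (by linarith)
    have h2 := h.strict_of_deriv hd hne (t := ε/2) (by linarith)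
    simp only [zero_smul, add_zero, zero_add] at h1
    have h3 : Gf g v z < ε/2 + Gf g v (z + (ε/2) • v) := lt_of_le_of_ne h1 h2.symm
    set η := ε/2 + Gf g v (z + (ε/2) • v) - Gf g v z with hη
    have hη0 : 0 < η := by linarith
    refine ⟨η/2, by linarith, ?_⟩
    have := h.of_lt_G (z := z + (ε/2) • v) (s := Gf g v (z + (ε/2) • v) - η/2) (by linarith)
    have e : z + (ε/2) • v + (Gf g v (z + (ε/2) • v) - η/2) • v = y + (η/2) • v := by
      rw [hy, Psi, add_assoc, add_assoc, ← add_smul, ← add_smul]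
      congr 2; rw [hη]; ring
    rw [e] at this
    linarith
  have dn : ∃ η : ℝ, 0 < η ∧ g y - ε / 2 ≤ g (y - η • v) := by
    have h1 := h.G_mono z (s := -(ε/2)) (t := 0) (by linarith)
    have h2 := h.strict_of_deriv hd hne (t := -(ε/2)) (by linarith)
    simp only [zero_smul, add_zero, zero_add] at h1
    have h3 : -(ε/2) + Gf g v (z + (-(ε/2)) • v) < Gf g v z := lt_of_le_of_ne h1 h2
    set η := Gf g v z - (-(ε/2) + Gf g v (z + (-(ε/2)) • v)) with hη
    have hη0 : 0 < η := by linarith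
    refine ⟨η/2, by linarith, ?_⟩
    have := h.of_G_lt (z := z + (-(ε/2)) • v) (s := Gf g v (z + (-(ε/2)) • v) + η/2) (by linarith)
    have e : z + (-(ε/2)) • v + (Gf g v (z + (-(ε/2)) • v) + η/2) • v = y - (η/2) • v := by
      rw [hy, Psi, sub_eq_add_neg, ← neg_smul, add_assoc, add_assoc, ← add_smul, ← add_smul]
      congr 2; rw [hη]; ring
    rw [e] at this
    linarith
  obtain ⟨η, hη, hup⟩ := up
  obtain ⟨η', hη', hdn⟩ := dn
  have hρ := h.pos
  have cone : ∀ (a : ℝ) (u : X), 0 < a → ‖u‖ < ρ * a → v + a⁻¹ • u ∈ Metric.ball v ρ := by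
    intro a u ha hu
    rw [Metric.mem_ball, dist_eq_norm, add_sub_cancel_left, norm_smul, Real.norm_eq_abs,
      abs_of_pos (inv_pos.2 ha), inv_mul_lt_iff₀ ha]
    linarith [mul_comm ρ a]
  refine ⟨min (ρ * η) (ρ * η'), by positivity, fun {x} hx => ?_⟩
  rw [dist_eq_norm] at hx
  have hx1 := lt_of_lt_of_le hx (min_le_left _ _)
  have hx2 := lt_of_lt_of_le hx (min_le_right _ _)
  have m1 := h.mono x _ (cone η (y - x) hη (by rwa [norm_sub_rev])) η hη.le
  have m2 := h.mono (y - η' • v) _ (cone η' (x - y) hη' hx2) η' hη'.le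
  rw [smul_add, smul_smul, mul_inv_cancel₀ hη.ne', one_smul] at m1
  rw [smul_add, smul_smul, mul_inv_cancel₀ hη'.ne', one_smul] at m2
  have e1 : x + (η • v + (y - x)) = y + η • v := by abel
  have e2 : y - η' • v + (η' • v + (x - y)) = x := by abel
  rw [e1] at m1; rw [e2] at m2
  rw [Real.dist_eq, abs_lt]
  constructor <;> linarith

/-- restriction to a finite dimensional affine subspace -/
lemma restrict (h : ConeMono g v ρ M) {E : Type*} [NormedAddCommGroup E] [NormedSpace ℝ E]
    (φ : E →L[ℝ] X) (e : E) (he : φ e = v) (x : X) :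
    ∃ ρ', ConeMono (fun t => g (x + φ t)) e ρ' M := by
  obtain ⟨s, hs, hh⟩ := Metric.mem_nhds_iff.1 (φ.continuous.continuousAt.preimage_mem_nhds (x := e)
    (t := Metric.ball v ρ) (by rw [he]; exact Metric.ball_mem_nhds _ h.pos))
  refine ⟨s, hs, fun y => h.bdd _, fun y w hw r hr => ?_⟩
  have := h.mono (x + φ y) (φ w) (hh hw) r hr
  simpa [add_assoc] using this

end ConeMono

lemma Gf_restrict {E : Type*} [NormedAddCommGroup E] [NormedSpace ℝ E]
    (φ : E →L[ℝ] X) (e : E) (he : φ e = v) (x : X) (t : E) :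
    Gf (fun t => g (x + φ t)) e t = Gf g v (x + φ t) := by
  simp [Gf, he, add_assoc]

lemma Psi_restrict {E : Type*} [NormedAddCommGroup E] [NormedSpace ℝ E]
    (φ : E →L[ℝ] X) (e : E) (he : φ e = v) (x : X) (t : E) :
    x + φ (Psi (fun t => g (x + φ t)) e t) = Psi g v (x + φ t) := by
  simp [Psi, Gf_restrict φ e he, he, add_assoc]

end cone

section fd
variable {n : ℕ} {g : (Fin n → ℝ) → ℝ} {v : Fin n → ℝ} {ρ M : ℝ}

lemma ConeMono.fd_ae (h : ConeMono g v ρ M) :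
    volume {t | ¬ ∃ z, DifferentiableAt ℝ (Gf g v) z ∧ fderiv ℝ (Gf g v) z v ≠ -1 ∧ Psi g v z = t} = 0 := by
  have hsub : {t | ¬ ∃ z, DifferentiableAt ℝ (Gf g v) z ∧ fderiv ℝ (Gf g v) z v ≠ -1 ∧ Psi g v z = t}
      ⊆ (Psi g v '' {z | ¬ DifferentiableAt ℝ (Gf g v) z}) ∪
        (Psi g v '' {z | DifferentiableAt ℝ (Gf g v) z ∧ fderiv ℝ (Gf g v) z v = -1}) := by
    intro t ht
    have hP := h.Psi_Phi t
    by_cases hd : DifferentiableAt ℝ (Gf g v) (t + g t • v)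
    · right
      refine ⟨_, ⟨hd, ?_⟩, hP⟩
      by_contra hc
      exact ht ⟨_, hd, hc, hP⟩
    · left; exact ⟨_, hd, hP⟩
  refine measure_mono_null hsub (measure_union_null ?_ ?_)
  · have hL : ∃ K, LipschitzWith K (Psi g v) := by
      have : LipschitzWith ‖(ContinuousLinearMap.toSpanSingleton ℝ v)‖₊ (fun s : ℝ => s • v) :=
        (ContinuousLinearMap.toSpanSingleton ℝ v).lipschitz
      exact ⟨_, LipschitzWith.id.add (this.comp h.G_lip)⟩
    obtain ⟨K, hK⟩ := hL
    have h0 : volume {z | ¬ DifferentiableAt ℝ (Gf g v) z} = 0 := by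
      have := h.G_lip.ae_differentiableAt (μ := volume)
      exact this
    rw [← hausdorffMeasure_pi_real] at h0 ⊢
    refine le_antisymm ?_ (zero_le)
    refine (hK.hausdorffMeasure_image_le (by positivity) _).trans ?_
    rw [h0]; simp
  · refine addHaar_image_eq_zero_of_det_fderivWithin_eq_zero volume
      (f' := fun z => ContinuousLinearMap.id ℝ _ + (fderiv ℝ (Gf g v) z).smulRight v) ?_ ?_
    · rintro z ⟨hd, -⟩
      exact ((hasFDerivAt_id z).add (hd.hasFDerivAt.smul_const v)).hasFDerivWithinAt
    · rintro z ⟨hd, he⟩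
      by_cases hv : v = 0
      · subst hv; simp at he
      by_contra hc
      have hc' : LinearMap.det ((ContinuousLinearMap.id ℝ _ + (fderiv ℝ (Gf g v) z).smulRight v : (Fin n → ℝ) →L[ℝ] (Fin n → ℝ)) : (Fin n → ℝ) →ₗ[ℝ] (Fin n → ℝ)) ≠ 0 := hc
      have hinj : Function.Injective ((ContinuousLinearMap.id ℝ _ + (fderiv ℝ (Gf g v) z).smulRight v : (Fin n → ℝ) →L[ℝ] (Fin n → ℝ)) : (Fin n → ℝ) →ₗ[ℝ] (Fin n → ℝ)) :=
        (LinearMap.equivOfDetNeZero _ hc').injective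
      apply hv
      apply hinj
      simp [he]

lemma ConeMono.fd_diff (h : ConeMono g v ρ M) (hv : v ≠ 0) {z : Fin n → ℝ} (hd : DifferentiableAt ℝ (Gf g v) z)
    (hne : fderiv ℝ (Gf g v) z v ≠ -1) : DifferentiableAt ℝ g (Psi g v z) := by
  have hl : LineDifferentiableAt ℝ (Gf g v) z v := hd.lineDifferentiableAt
  have hle : lineDeriv ℝ (Gf g v) z v ≠ -1 := by rwa [hd.lineDeriv_eq_fderiv]
  have hc := h.continuousAt hl hle hv
  set y := Psi g v z with hy
  have hz : y + g y • v = z := h.Psi_inj hv hl hle (by rw [h.Psi_Phi])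
  set A : (Fin n → ℝ) →L[ℝ] (Fin n → ℝ) := ContinuousLinearMap.id ℝ _ + (fderiv ℝ (Gf g v) z).smulRight v with hA
  have hAd : HasFDerivAt (Psi g v) A z := (hasFDerivAt_id z).add (hd.hasFDerivAt.smul_const v)
  have hinj : Function.Injective (A : (Fin n → ℝ) →ₗ[ℝ] (Fin n → ℝ)) := by
    rw [← LinearMap.ker_eq_bot, LinearMap.ker_eq_bot']
    intro u hu
    have hu' : u + fderiv ℝ (Gf g v) z u • v = 0 := by simpa [hA] using hu
    have h1 : fderiv ℝ (Gf g v) z u * (1 + fderiv ℝ (Gf g v) z v) = 0 := by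
      have := congrArg (fderiv ℝ (Gf g v) z) hu'
      rw [map_add, map_smul, map_zero, smul_eq_mul] at this
      linarith
    rcases mul_eq_zero.1 h1 with h2 | h2
    · rw [h2] at hu'; simpa using hu'
    · exact absurd (by linarith) hne
  let A' : (Fin n → ℝ) ≃L[ℝ] (Fin n → ℝ) := (LinearEquiv.ofInjectiveEndo _ hinj).toContinuousLinearEquiv
  have hA' : (A' : (Fin n → ℝ) →L[ℝ] (Fin n → ℝ)) = A := by ext; rfl
  have hPc : ContinuousAt (fun y => y + g y • v) y := continuousAt_id.add (hc.smul continuousAt_const)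
  have hP : HasFDerivAt (fun y => y + g y • v) (A'.symm : (Fin n → ℝ) →L[ℝ] (Fin n → ℝ)) y := by
    refine HasFDerivAt.of_local_left_inverse (f := Psi g v) hPc ?_ ?_
    · rw [hA']; show HasFDerivAt (Psi g v) A (y + g y • v); rw [hz]; exact hAd
    · exact Eventually.of_forall fun y => h.Psi_Phi y
  obtain ⟨i, hi⟩ : ∃ i, v i ≠ 0 := by
    by_contra! hc; exact hv (funext hc)
  have h3 : DifferentiableAt ℝ (fun y : Fin n → ℝ => ((y + g y • v) i - y i) * (v i)⁻¹) y := by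
    have h4 : DifferentiableAt ℝ (fun y : Fin n → ℝ => (y + g y • v) i) y :=
      differentiableAt_pi.1 hP.differentiableAt i
    have h5 : DifferentiableAt ℝ (fun y : Fin n → ℝ => y i) y := by fun_prop
    exact (h4.sub h5).mul_const _
  convert h3 using 2 with y
  simp [hi]

end fd


lemma gat_iff {X : Type*} [NormedAddCommGroup X] [NormedSpace ℝ X] (f : X → ℝ) (x h : X) (a : ℝ) :
    Tendsto (fun t : ℝ => (f (x + t • h) - f x) / t) (𝓝[≠] 0) (𝓝 a) ↔
      HasDerivAt (fun t : ℝ => f (x + t • h)) a 0 := by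
  rw [hasDerivAt_iff_tendsto_slope]
  apply iff_of_eq
  congr 1
  ext t
  simp [slope_def_field]

section coneC
variable {X : Type*} [NormedAddCommGroup X] [NormedSpace ℝ X]
variable {g : X → ℝ} {v : X} {ρ M : ℝ}

/-- regular points -/
def Rset (g : X → ℝ) (v : X) {n : ℕ} (φ : (Fin n → ℝ) →L[ℝ] X) : Set X :=
  {z | DifferentiableAt ℝ (fun t => Gf g v (z + φ t)) 0 ∧ lineDeriv ℝ (Gf g v) z v ≠ -1}

lemma Rset_line {n : ℕ} {φ : (Fin n → ℝ) →L[ℝ] X} {e : Fin n → ℝ} (he : φ e = v) {z : X}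
    (hz : z ∈ Rset g v φ) : LineDifferentiableAt ℝ (Gf g v) z v := by
  have h1 : DifferentiableAt ℝ (fun s : ℝ => s • e) 0 := by fun_prop
  have h2 := hz.1
  have h3 : DifferentiableAt ℝ (fun t => Gf g v (z + φ t)) ((fun s : ℝ => s • e) 0) := by simpa using h2
  have := DifferentiableAt.comp (g := fun t => Gf g v (z + φ t)) (f := fun s : ℝ => s • e) 0 h3 h1
  unfold LineDifferentiableAt
  have e1 : (fun s : ℝ => Gf g v (z + s • v)) = (fun t => Gf g v (z + φ t)) ∘ (fun s : ℝ => s • e) := by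
    ext s; simp [he]
  rw [e1]; exact this

lemma Gf_cont (h : ConeMono g v ρ M) : Continuous (Gf g v) := h.G_lip.continuous

lemma Rset_meas [CompleteSpace X] [TopologicalSpace.SeparableSpace X] [MeasurableSpace X] [BorelSpace X]
    (h : ConeMono g v ρ M) {n : ℕ} (φ : (Fin n → ℝ) →L[ℝ] X) : MeasurableSet (Rset g v φ) := by
  have : SecondCountableTopology X := UniformSpace.secondCountable_of_separable X
  have hc := Gf_cont h
  have h1 : MeasurableSet {p : X × (Fin n → ℝ) | DifferentiableAt ℝ ((fun z t => Gf g v (z + φ t)) p.1) p.2} :=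
    measurableSet_of_differentiableAt_with_param ℝ (f := fun z t => Gf g v (z + φ t)) (by fun_prop)
  have h2 : Measurable (fun z : X => (z, (0 : Fin n → ℝ))) := by fun_prop
  have h3 := h2 h1
  have h4 : Measurable (fun x ↦ lineDeriv ℝ (Gf g v) x v) := measurable_lineDeriv hc
  exact h3.inter (h4 (measurableSet_singleton (-1)).compl)

lemma Good_meas [CompleteSpace X] [TopologicalSpace.SeparableSpace X] [MeasurableSpace X] [BorelSpace X]
    (h : ConeMono g v ρ M) (hv : v ≠ 0) {n : ℕ} (φ : (Fin n → ℝ) →L[ℝ] X) {e : Fin n → ℝ} (he : φ e = v) :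
    MeasurableSet (Psi g v '' Rset g v φ) := by
  have : SecondCountableTopology X := UniformSpace.secondCountable_of_separable X
  have hc := Gf_cont h
  refine (Rset_meas h φ).image_of_continuousOn_injOn ?_ ?_
  · unfold Psi; fun_prop
  · intro a ha b hb hab
    exact (h.Psi_inj hv (Rset_line he ha) ha.2 hab).symm

lemma Good_null (h : ConeMono g v ρ M) {n : ℕ} (φ : (Fin n → ℝ) →L[ℝ] X) {e : Fin n → ℝ} (he : φ e = v) :
    FinDimNull (Psi g v '' Rset g v φ)ᶜ := by
  refine ⟨n, φ, fun x => ?_⟩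
  obtain ⟨ρ', h'⟩ := h.restrict φ e he x
  refine measure_mono_null ?_ h'.fd_ae
  rintro t ht ⟨z, hz, hz2, rfl⟩
  apply ht
  refine ⟨x + φ z, ⟨?_, ?_⟩, ?_⟩
  · have hG : Gf (fun t => g (x + φ t)) e = fun t => Gf g v (x + φ t) := funext fun t => Gf_restrict φ e he x t
    rw [hG] at hz
    have h1 : DifferentiableAt ℝ (fun t : Fin n → ℝ => z + t) 0 := by fun_prop
    have h3 : DifferentiableAt ℝ (fun t => Gf g v (x + φ t)) ((fun t : Fin n → ℝ => z + t) 0) := by simpa using hz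
    have := DifferentiableAt.comp (g := fun t => Gf g v (x + φ t)) (f := fun t : Fin n → ℝ => z + t) 0 h3 h1
    have e1 : (fun t => Gf g v (x + φ z + φ t)) = (fun t => Gf g v (x + φ t)) ∘ (fun t : Fin n → ℝ => z + t) := by
      ext s; simp [add_assoc]
    rw [e1]; exact this
  · rw [← hz.lineDeriv_eq_fderiv] at hz2
    convert hz2 using 1
    unfold lineDeriv
    congr 1
    ext s
    rw [Gf_restrict φ e he]
    simp [he, add_assoc]
  · rw [Psi_restrict φ e he]

lemma Good_diff (h : ConeMono g v ρ M) (hv : v ≠ 0) {n : ℕ} (φ : (Fin n → ℝ) →L[ℝ] X) {e : Fin n → ℝ} (he : φ e = v)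
    {y : X} (hy : y ∈ Psi g v '' Rset g v φ) :
    ContinuousAt g y ∧ DifferentiableAt ℝ (fun t => g (y + φ t)) 0 := by
  obtain ⟨z, hz, rfl⟩ := hy
  have hl := Rset_line he hz
  refine ⟨h.continuousAt hl hz.2 hv, ?_⟩
  set y := Psi g v z with hy
  have hzy : y + g y • v = z := h.Psi_inj hv hl hz.2 (by rw [h.Psi_Phi])
  obtain ⟨ρ', h'⟩ := h.restrict φ e he y
  have he0 : e ≠ 0 := by rintro rfl; exact hv (by simpa using he.symm)
  have hG : Gf (fun t => g (y + φ t)) e = fun t => Gf g v (y + φ t) := funext fun t => Gf_restrict φ e he y t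
  have hd : DifferentiableAt ℝ (Gf (fun t => g (y + φ t)) e) (g y • e) := by
    rw [hG]
    have h1 : DifferentiableAt ℝ (fun t : Fin n → ℝ => t - g y • e) (g y • e) := by fun_prop
    have h3 : DifferentiableAt ℝ (fun t => Gf g v (z + φ t)) ((fun t : Fin n → ℝ => t - g y • e) (g y • e)) := by
      simpa using hz.1
    have := DifferentiableAt.comp (g := fun t => Gf g v (z + φ t)) (f := fun t : Fin n → ℝ => t - g y • e) _ h3 h1
    have e1 : (fun t => Gf g v (y + φ t)) = (fun t => Gf g v (z + φ t)) ∘ (fun t : Fin n → ℝ => t - g y • e) := by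
      ext s
      rw [← hzy]
      simp [he, add_assoc]
    rw [e1]; exact this
  have hP : Psi (fun t => g (y + φ t)) e (g y • e) = 0 := by
    have := h'.Psi_Phi 0
    simpa using this
  have := h'.fd_diff he0 hd ?_
  · rwa [hP] at this
  · rw [← hd.lineDeriv_eq_fderiv]
    have h2 := hz.2
    convert h2 using 1
    unfold lineDeriv
    congr 1
    ext s
    rw [Gf_restrict φ e he, ← hzy]
    simp [he, add_assoc]

lemma cone_step (h : ConeMono g v ρ M) (y u : X) {c s : ℝ} (hc : 0 < c) (hu : ‖u‖ < ρ * c) (hs : 0 ≤ s) :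
    g y ≤ g (y + s • (c • v + u)) := by
  have hb : v + c⁻¹ • u ∈ Metric.ball v ρ := by
    rw [Metric.mem_ball, dist_eq_norm]
    rw [add_sub_cancel_left, norm_smul, Real.norm_of_nonneg (by positivity), inv_mul_lt_iff₀ hc]
    linarith
  have := h.mono y _ hb (s * c) (by positivity)
  rwa [smul_add, smul_smul, mul_assoc, mul_inv_cancel₀ hc.ne', mul_one, mul_smul, ← smul_add] at this

lemma gateaux_of_span (h : ConeMono g v ρ M) (S : Submodule ℝ X) (hS : Dense (S : Set X)) (hvS : v ∈ S) (y : X)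
    (D : S →ₗ[ℝ] ℝ) (hD : ∀ q : S, HasDerivAt (fun t : ℝ => g (y + t • (q : X))) (D q) 0) :
    ∃ L : X →L[ℝ] ℝ, GateauxDiffAt g y L := by
  have hρ := h.pos
  set V : S := ⟨v, hvS⟩ with hV
  have key : ∀ (q : S) (c : ℝ), 0 < c → ‖(q : X)‖ < ρ * c → 0 ≤ c * D V + D q := by
    intro q c hc hq
    have h1 := (gat_iff _ _ _ _).2 (hD (c • V + q))
    rw [map_add, map_smul, smul_eq_mul] at h1
    have h2 := h1.mono_left (nhdsWithin_mono 0 (fun x (hx : 0 < x) => ne_of_gt hx) : 𝓝[>] (0:ℝ) ≤ _)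
    refine ge_of_tendsto h2 ?_
    filter_upwards [self_mem_nhdsWithin] with t ht
    have := cone_step h y (q : X) hc hq (le_of_lt ht)
    apply div_nonneg _ (le_of_lt ht)
    simp only [hV, Submodule.coe_add, Submodule.coe_smul]
    linarith
  have hDv : 0 ≤ D V := by
    have := key 0 1 one_pos (by simpa using hρ)
    simpa using this
  have bound : ∀ q : S, ‖D q‖ ≤ (2 / ρ * D V) * ‖q‖ := by
    intro q
    by_cases hq : q = 0
    · subst hq; simp
    have hq' : 0 < ‖(q : X)‖ := by simpa using hq
    have hlt : ‖(q : X)‖ < ρ * (2 * ‖(q : X)‖ / ρ) := by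
      rw [mul_div_cancel₀ _ hρ.ne']; linarith
    have k1 := key q (2 * ‖(q : X)‖ / ρ) (by positivity) hlt
    have k2 := key (-q) (2 * ‖(q : X)‖ / ρ) (by positivity) (by simpa using hlt)
    rw [map_neg] at k2
    have e : (2 / ρ * D V) * ‖q‖ = 2 * ‖(q : X)‖ / ρ * D V := by
      rw [Submodule.coe_norm]; ring
    rw [e, Real.norm_eq_abs, abs_le]
    constructor <;> linarith
  obtain ⟨L, hL, -⟩ := exists_extension_norm_eq S (D.mkContinuous _ bound)
  have hL' : ∀ q : S, L q = D q := fun q => by rw [hL]; rfl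
  refine ⟨L, fun k => ?_⟩
  have approx : ∀ δ > 0, ∃ ε > 0, ∃ q : S, ‖k - q‖ < ρ * ε ∧ ‖((q + ε • V : S) : X) - k‖ < δ ∧ ‖((q - ε • V : S) : X) - k‖ < δ := by
    intro δ hδ
    set ε := δ / (2 * (ρ + ‖v‖)) with hε
    have hn : 0 < ρ + ‖v‖ := by positivity
    have hεp : 0 < ε := by positivity
    obtain ⟨q, hqS, hq⟩ := Metric.dense_iff.1 hS k (ρ * ε) (by positivity)
    rw [Metric.mem_ball, dist_eq_norm] at hqS
    have hb : ρ * ε + ε * ‖v‖ < δ := by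
      have : ρ * ε + ε * ‖v‖ = δ / 2 := by rw [hε]; field_simp
      linarith
    refine ⟨ε, hεp, ⟨q, hq⟩, by rwa [norm_sub_rev], ?_, ?_⟩
    · have : ((⟨q, hq⟩ + ε • V : S) : X) - k = (q - k) + ε • v := by simp [hV]; abel
      rw [this]
      refine (norm_add_le _ _).trans_lt ?_
      rw [norm_smul, Real.norm_of_nonneg hεp.le]; linarith
    · have : ((⟨q, hq⟩ - ε • V : S) : X) - k = (q - k) - ε • v := by simp [hV]; abel
      rw [this]
      refine (norm_sub_le _ _).trans_lt ?_
      rw [norm_smul, Real.norm_of_nonneg hεp.le]; linarith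
  -- comparison of slopes
  have slopes : ∀ (a b : X), (∀ s ≥ (0:ℝ), ∀ z, g z ≤ g (z + s • (b - a))) → ∀ t : ℝ, t ≠ 0 →
      (g (y + t • a) - g y) / t ≤ (g (y + t • b) - g y) / t := by
    intro a b hab t ht
    rcases lt_or_gt_of_ne ht with h0 | h0
    · have := hab (-t) (by linarith) (y + t • b)
      have e : y + t • b + (-t) • (b - a) = y + t • a := by module
      rw [e] at this
      exact div_le_div_of_nonpos_of_le h0.le (by linarith)
    · have := hab t h0.le (y + t • a)
      have e : y + t • a + t • (b - a) = y + t • b := by module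
      rw [e] at this
      gcongr
  rw [tendsto_order]
  constructor
  · intro a ha
    obtain ⟨δ, hδ, hd⟩ := Metric.continuousAt_iff.1 (L.continuous.continuousAt (x := k)) (L k - a) (by linarith)
    obtain ⟨ε, hε, q, h1, -, h2⟩ := approx δ hδ
    have h3 := hd (x := (q - ε • V : S)) (by rwa [dist_eq_norm])
    rw [Real.dist_eq, abs_lt, hL'] at h3
    have h4 := (tendsto_order.1 ((gat_iff _ _ _ _).2 (hD (q - ε • V)))).1 a (by linarith)
    filter_upwards [h4, self_mem_nhdsWithin] with t ht ht0
    refine ht.trans_le (slopes _ _ ?_ t ht0)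
    intro s hs z
    have := cone_step h z (k - q) hε h1 hs
    convert this using 4
    simp [hV]; abel
  · intro a ha
    obtain ⟨δ, hδ, hd⟩ := Metric.continuousAt_iff.1 (L.continuous.continuousAt (x := k)) (a - L k) (by linarith)
    obtain ⟨ε, hε, q, h1, h2, -⟩ := approx δ hδ
    have h3 := hd (x := (q + ε • V : S)) (by rwa [dist_eq_norm])
    rw [Real.dist_eq, abs_lt, hL'] at h3
    have h4 := (tendsto_order.1 ((gat_iff _ _ _ _).2 (hD (q + ε • V)))).2 a (by linarith)
    filter_upwards [h4, self_mem_nhdsWithin] with t ht ht0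
    refine (slopes _ _ ?_ t ht0).trans_lt ht
    intro s hs z
    have := cone_step h z (q - k) hε (by rwa [norm_sub_rev]) hs
    convert this using 4
    simp [hV]; abel

/-- `t ↦ ∑ tᵢ wᵢ` -/
noncomputable def phiN (w : ℕ → X) (n : ℕ) : (Fin n → ℝ) →L[ℝ] X :=
  ∑ i : Fin n, (ContinuousLinearMap.proj (R := ℝ) (φ := fun _ : Fin n => ℝ) i).smulRight (w i)

lemma phiN_apply (w : ℕ → X) (n : ℕ) (t : Fin n → ℝ) : phiN w n t = ∑ i : Fin n, t i • w i := by
  simp [phiN, ContinuousLinearMap.sum_apply]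

lemma phiN_finsupp (w : ℕ → X) (c : ℕ →₀ ℝ) {n : ℕ} (hn : ∀ i ∈ c.support, i < n) :
    phiN w n (fun i => c i) = Finsupp.linearCombination ℝ w c := by
  rw [phiN_apply, Finsupp.linearCombination_apply, Finsupp.sum, Fin.sum_univ_eq_sum_range (fun i => c i • w i)]
  symm
  apply Finset.sum_subset
  · intro i hi; simpa using hn i hi
  · intro i _ hi; rw [Finsupp.notMem_support_iff.1 hi, zero_smul]

lemma gateaux_of_good (h : ConeMono g v ρ M) (w : ℕ → X) (hw0 : w 0 = v) (hw : DenseRange w) (y : X)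
    (hy : ∀ n, DifferentiableAt ℝ (fun t => g (y + phiN w (n + 1) t)) 0) :
    ∃ L : X →L[ℝ] ℝ, GateauxDiffAt g y L := by
  have hderiv : ∀ (n : ℕ) (t : Fin (n+1) → ℝ), HasDerivAt (fun s : ℝ => g (y + s • phiN w (n+1) t))
      (fderiv ℝ (fun t => g (y + phiN w (n + 1) t)) 0 t) 0 := by
    intro n t
    have := (hy n).hasFDerivAt.hasLineDerivAt t
    unfold HasLineDerivAt at this
    simpa using this
  have hex : ∀ c : ℕ →₀ ℝ, ∃ n, ∀ m ≥ n, ∀ i ∈ c.support, i < m + 1 := by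
    intro c
    refine ⟨c.support.sup id, fun m hm i hi => ?_⟩
    have : i ≤ c.support.sup id := Finset.le_sup (f := id) hi
    omega
  have hval : ∀ (c : ℕ →₀ ℝ) (n : ℕ), (∀ i ∈ c.support, i < n + 1) →
      HasDerivAt (fun s : ℝ => g (y + s • Finsupp.linearCombination ℝ w c))
        (fderiv ℝ (fun t => g (y + phiN w (n + 1) t)) 0 (fun i => c i)) 0 := by
    intro c n hn
    have := hderiv n (fun i => c i)
    rwa [phiN_finsupp w c hn] at this
  set S := Submodule.span ℝ (range w) with hSdef
  have hrep : ∀ q : S, ∃ c : ℕ →₀ ℝ, Finsupp.linearCombination ℝ w c = q := fun q =>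
    (Finsupp.mem_span_range_iff_exists_finsupp.1 q.2).imp fun c hc => by
      rw [Finsupp.linearCombination_apply]; exact hc
  have hd : ∀ q : S, HasDerivAt (fun s : ℝ => g (y + s • (q : X))) (lineDeriv ℝ g y (q : X)) 0 := by
    intro q
    obtain ⟨c, hc⟩ := hrep q
    obtain ⟨n, hn⟩ := hex c
    have h1 := hval c n (hn n le_rfl)
    rw [hc] at h1
    have h2 : HasLineDerivAt ℝ g _ y (q : X) := h1
    rw [h2.lineDeriv]; exact h1
  let D : S →ₗ[ℝ] ℝ :=
    { toFun := fun q => lineDeriv ℝ g y (q : X)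
      map_add' := by
        intro p q
        obtain ⟨c, hc⟩ := hrep p
        obtain ⟨d, hd'⟩ := hrep q
        obtain ⟨n1, hn1⟩ := hex c
        obtain ⟨n2, hn2⟩ := hex d
        obtain ⟨n3, hn3⟩ := hex (c + d)
        set n := max n1 (max n2 n3)
        have k1 := hval c n (hn1 n (by omega))
        have k2 := hval d n (hn2 n (by omega))
        have k3 := hval (c + d) n (hn3 n (by omega))
        rw [map_add] at k3
        rw [hc, hd'] at k3
        rw [hc] at k1
        rw [hd'] at k2
        have e1 := (hd p).unique k1
        have e2 := (hd q).unique k2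
        have e3 := (hd (p + q)).unique k3
        rw [e1, e2, e3, ← map_add]
        rfl
      map_smul' := by
        intro r p
        simpa using lineDeriv_smul (𝕜 := ℝ) (f := g) (x := y) (v := (p : X)) (c := r) }
  exact gateaux_of_span h S (hw.mono Submodule.subset_span) (Submodule.subset_span ⟨0, hw0⟩) y D hd

theorem cone_mono_thm [CompleteSpace X] [TopologicalSpace.SeparableSpace X] [MeasurableSpace X] [BorelSpace X]
    (h : ConeMono g v ρ M) (hv : v ≠ 0) :
    ∃ B : ℕ → Set X, (∀ n, MeasurableSet (B n)) ∧ (∀ n, FinDimNull (B n)) ∧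
      ∀ y, (∀ n, y ∉ B n) → ContinuousAt g y ∧ ∃ L : X →L[ℝ] ℝ, GateauxDiffAt g y L := by
  let w : ℕ → X := fun n => Nat.casesOn n v (fun i => TopologicalSpace.denseSeq X i)
  have hw : DenseRange w := by
    refine (TopologicalSpace.denseRange_denseSeq X).mono ?_
    rintro _ ⟨i, rfl⟩
    exact ⟨i + 1, rfl⟩
  have he : ∀ n, phiN w (n+1) (Pi.single 0 1) = v := by
    intro n
    rw [phiN_apply, Finset.sum_eq_single 0]
    · simp [w]
    · intro b _ hb; simp [Pi.single_eq_of_ne hb]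
    · simp
  refine ⟨fun n => (Psi g v '' Rset g v (phiN w (n+1)))ᶜ, fun n => (Good_meas h hv _ (he n)).compl,
    fun n => Good_null h _ (he n), fun y hy => ?_⟩
  have hg : ∀ n, y ∈ Psi g v '' Rset g v (phiN w (n+1)) := fun n => not_not.1 (hy n)
  exact ⟨(Good_diff h hv _ (he 0) (hg 0)).1,
    gateaux_of_good h w rfl hw y fun n => (Good_diff h hv _ (he n) (hg n)).2⟩

end coneC


section locD
variable {X : Type*} [NormedAddCommGroup X] [NormedSpace ℝ X]

lemma qc_mono {f : X → ℝ} (hq : QuasiconvexFun f) {α ρ : ℝ} {a v : X}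
    (hball : ∀ x ∈ Metric.ball a ρ, f x < α) {x w : X} (hx : α ≤ f x) (hxv : x ∈ Metric.ball (a + v) (ρ/2))
    (hw : w ∈ Metric.ball v (ρ/2)) {s : ℝ} (hs : 0 ≤ s) : f x ≤ f (x + s • w) := by
  have hp : f (x - w) < α := by
    apply hball
    rw [Metric.mem_ball, dist_eq_norm] at *
    have : x - w - a = (x - (a + v)) - (w - v) := by abel
    rw [this]
    refine (norm_sub_le _ _).trans_lt ?_
    linarith
  have h1 := hq (x - w) (x + s • w) (s / (1 + s)) ⟨by positivity, by rw [div_le_one (by positivity)]; linarith⟩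
  have e : (s / (1 + s)) • (x - w) + (1 - s / (1 + s)) • (x + s • w) = x := by
    have : 1 - s / (1 + s) = 1 / (1 + s) := by field_simp; ring
    rw [this]
    have h0 : (1 + s) ≠ 0 := by positivity
    match_scalars <;> field_simp <;> ring
  rw [e] at h1
  rcases le_max_iff.1 h1 with h2 | h2
  · linarith
  · exact h2

/-- monotone extension -/
noncomputable def extG (f : X → ℝ) (W : Set X) (v : X) (r : ℝ) (x : X) : ℝ :=
  sSup (insert (-2) {c | ∃ y ∈ W, ∃ s : ℝ, 0 ≤ s ∧ ∃ w ∈ Metric.ball v r, x = y + s • w ∧ c = Real.arctan (f y)})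

lemma arctan_abs (x : ℝ) : |Real.arctan x| ≤ 2 := by
  have h1 := Real.arctan_lt_pi_div_two x
  have h2 := Real.neg_pi_div_two_lt_arctan x
  have h3 := Real.pi_le_four
  rw [abs_le]; constructor <;> linarith

lemma extG_bdd (f : X → ℝ) (W : Set X) (v : X) (r : ℝ) (x : X) : BddAbove
    (insert (-2) {c | ∃ y ∈ W, ∃ s : ℝ, 0 ≤ s ∧ ∃ w ∈ Metric.ball v r, x = y + s • w ∧ c = Real.arctan (f y)}) := by
  refine ⟨2, ?_⟩
  rintro c (rfl | ⟨y, -, s, -, w, -, -, rfl⟩)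
  · norm_num
  · exact (abs_le.1 (arctan_abs _)).2

lemma extG_cone (f : X → ℝ) (W : Set X) (v : X) {r : ℝ} (hr : 0 < r) : ConeMono (extG f W v r) v r 2 := by
  refine ⟨hr, fun y => ?_, fun x w hw s hs => ?_⟩
  · rw [abs_le]
    refine ⟨le_csSup (extG_bdd f W v r y) (mem_insert _ _), csSup_le ⟨_, mem_insert _ _⟩ ?_⟩
    rintro c (rfl | ⟨y, -, s, -, w, -, -, rfl⟩)
    · norm_num
    · exact (abs_le.1 (arctan_abs _)).2
  · refine csSup_le_csSup (extG_bdd f W v r _) ⟨_, mem_insert _ _⟩ ?_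
    refine insert_subset_insert ?_
    rintro c ⟨y, hy, s1, hs1, w1, hw1, rfl, rfl⟩
    by_cases h0 : s1 + s = 0
    · have e1 : s1 = 0 := by linarith
      have e2 : s = 0 := by linarith
      subst e1 e2
      exact ⟨y, hy, 0, le_rfl, w, hw, by simp, rfl⟩
    · have hp : 0 < s1 + s := lt_of_le_of_ne (by positivity) (Ne.symm h0)
      refine ⟨y, hy, s1 + s, hp.le, (s1 / (s1 + s)) • w1 + (s / (s1 + s)) • w, ?_, ?_, rfl⟩
      · exact convex_ball v r hw1 hw (by positivity) (by positivity) (by field_simp)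
      · rw [smul_add, smul_smul, smul_smul, mul_div_cancel₀ _ h0, mul_div_cancel₀ _ h0, add_assoc]

lemma extG_eq {f : X → ℝ} {W : Set X} {v : X} {r : ℝ} (hr : 0 < r)
    (hm : ∀ x ∈ W, ∀ w ∈ Metric.ball v r, ∀ s : ℝ, 0 ≤ s → f x ≤ f (x + s • w)) {x : X} (hx : x ∈ W) :
    extG f W v r x = Real.arctan (f x) := by
  apply le_antisymm
  · refine csSup_le ⟨_, mem_insert _ _⟩ ?_
    rintro c (rfl | ⟨y, hy, s, hs, w, hw, rfl, rfl⟩)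
    · exact (abs_le.1 (arctan_abs _)).1
    · exact Real.arctan_strictMono.monotone (hm y hy w hw s hs)
  · exact le_csSup (extG_bdd f W v r x) (mem_insert_of_mem _ ⟨x, hx, 0, le_rfl, v, Metric.mem_ball_self hr, by simp, rfl⟩)

lemma local_thm [CompleteSpace X] [TopologicalSpace.SeparableSpace X] [MeasurableSpace X] [BorelSpace X]
    {f : X → ℝ} (hq : QuasiconvexFun f) {α ρ : ℝ} (hρ : 0 < ρ) {a v : X} (hv : v ≠ 0)
    (hball : ∀ x ∈ Metric.ball a ρ, f x < α) {V : Set X} (hV : IsOpen V) (hfV : ∀ x ∈ V, α ≤ f x) :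
    ∃ B : ℕ → Set X, (∀ n, MeasurableSet (B n)) ∧ (∀ n, FinDimNull (B n)) ∧
      ∀ y ∈ V ∩ Metric.ball (a + v) (ρ/2), (∀ n, y ∉ B n) → ContinuousAt f y ∧ EssGateauxDiffAt f y := by
  set W := V ∩ Metric.ball (a + v) (ρ/2) with hW
  have hWo : IsOpen W := hV.inter Metric.isOpen_ball
  have hm : ∀ x ∈ W, ∀ w ∈ Metric.ball v (ρ/2), ∀ s : ℝ, 0 ≤ s → f x ≤ f (x + s • w) :=
    fun x hx w hw s hs => qc_mono hq hball (hfV x hx.1) hx.2 hw hs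
  have hc := extG_cone f W v (half_pos hρ)
  have heq : ∀ x ∈ W, extG f W v (ρ/2) x = Real.arctan (f x) := fun x hx => extG_eq (half_pos hρ) hm hx
  obtain ⟨B, hB1, hB2, hB3⟩ := cone_mono_thm hc hv
  refine ⟨B, hB1, hB2, fun y hy hyB => ?_⟩
  obtain ⟨hcont, L, hL⟩ := hB3 y hyB
  set g := extG f W v (ρ/2) with hg
  have hev : f =ᶠ[𝓝 y] fun x => Real.tan (g x) := by
    filter_upwards [hWo.mem_nhds hy] with x hx
    rw [heq x hx, Real.tan_arctan]
  have hcos : Real.cos (g y) ≠ 0 := by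
    rw [heq y hy]; exact (Real.cos_arctan_pos _).ne'
  refine ⟨?_, ?_⟩
  · refine ContinuousAt.congr ?_ hev.symm
    exact (Real.continuousAt_tan.2 hcos).comp hcont
  · refine ⟨(1 / Real.cos (g y) ^ 2) • L, univ, by rw [compl_univ]; exact IsMeagre.empty, fun h _ => ?_⟩
    rw [gat_iff]
    have h1 := (gat_iff _ _ _ _).1 (hL (h : X))
    have h2 : HasDerivAt Real.tan (1 / Real.cos (g y) ^ 2) (g (y + (0:ℝ) • (h : X))) := by
      simpa using Real.hasDerivAt_tan hcos
    have h3 := h2.comp 0 h1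
    refine HasDerivAt.congr_of_eventuallyEq h3 ?_
    have hct : ContinuousAt (fun t : ℝ => y + t • (h : X)) 0 := by fun_prop
    have := hct.eventually (p := fun x => f x = Real.tan (g x)) (by simp only [zero_smul, add_zero]; exact hev)
    exact this

/-- the part of the space away from `closure {f < α}` -/
lemma outer_thm [CompleteSpace X] [TopologicalSpace.SeparableSpace X] [MeasurableSpace X] [BorelSpace X]
    {f : X → ℝ} (hq : QuasiconvexFun f) (α : ℝ) (hne : (interior {x | f x < α}).Nonempty) :
    ∃ B : ℕ × ℕ → Set X, (∀ n, MeasurableSet (B n)) ∧ (∀ n, FinDimNull (B n)) ∧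
      ∀ y ∉ closure {x | f x < α}, (∀ n, y ∉ B n) → ContinuousAt f y ∧ EssGateauxDiffAt f y := by
  obtain ⟨a, ha⟩ := hne
  obtain ⟨ρ, hρ, hb⟩ := Metric.mem_nhds_iff.1 (mem_interior_iff_mem_nhds.1 ha)
  set V := (closure {x | f x < α})ᶜ with hVd
  have hV : IsOpen V := isClosed_closure.isOpen_compl
  have hfV : ∀ x ∈ V, α ≤ f x := fun x hx => by
    by_contra hc
    exact hx (subset_closure (not_le.1 hc))
  have key : ∀ i : ℕ, ∃ B : ℕ → Set X, (∀ n, MeasurableSet (B n)) ∧ (∀ n, FinDimNull (B n)) ∧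
      ∀ y ∈ V ∩ Metric.ball (a + TopologicalSpace.denseSeq X i) (ρ/2), (∀ n, y ∉ B n) →
        ContinuousAt f y ∧ EssGateauxDiffAt f y := by
    intro i
    by_cases h0 : TopologicalSpace.denseSeq X i = 0
    · refine ⟨fun _ => ∅, fun _ => MeasurableSet.empty, fun _ => ⟨0, 0, by simp⟩, ?_⟩
      rintro y ⟨hy, hy2⟩
      exfalso
      rw [h0, add_zero] at hy2
      have := hb (Metric.ball_subset_ball (by linarith) hy2)
      exact absurd (hfV y hy) (not_le.2 this)
    · exact local_thm hq hρ h0 hb hV hfV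
  choose B h1 h2 h3 using key
  refine ⟨fun p => B p.1 p.2, fun p => h1 _ _, fun p => h2 _ _, fun y hy hyB => ?_⟩
  obtain ⟨_, hm, i, rfl⟩ := Metric.dense_iff.1 (TopologicalSpace.denseRange_denseSeq X) (y - a) (ρ/2) (half_pos hρ)
  refine h3 i y ⟨hy, ?_⟩ fun n => hyB (i, n)
  rw [Metric.mem_ball, dist_eq_norm] at *
  rw [norm_sub_rev] at hm
  have e : y - (a + TopologicalSpace.denseSeq X i) = y - a - TopologicalSpace.denseSeq X i := by abel
  rw [e]; exact hm

end locD


section intE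
variable {X : Type*} [NormedAddCommGroup X] [NormedSpace ℝ X]

lemma qc_convex {f : X → ℝ} (hq : QuasiconvexFun f) (c : ℝ) : Convex ℝ {x | f x < c} := by
  intro x hx y hy a b ha hb hab
  have : b = 1 - a := by linarith
  subst this
  exact (hq x y a ⟨ha, by linarith⟩).trans_lt (max_lt hx hy)

lemma line_convex {f : X → ℝ} (hq : QuasiconvexFun f) (c : ℝ) (x h : X) (σ : ℝ) :
    Convex ℝ {t : ℝ | f (x + (σ * t) • h) < c} := by
  intro s hs t ht a b ha hb hab
  have := qc_convex hq c hs ht ha hb hab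
  have e : a • (x + (σ * s) • h) + b • (x + (σ * t) • h) = x + (σ * (a • s + b • t)) • h := by
    have : b = 1 - a := by linarith
    subst this
    simp only [smul_eq_mul]
    module
  rw [e] at this
  exact this

/-- the essential minimal set -/
def Dset (f : X → ℝ) : Set X :=
  ⋂ (q : ℚ) (_ : (interior {x | f x < (q : ℝ)}).Nonempty), closure {x | f x < (q : ℝ)}

lemma Dset_closed (f : X → ℝ) : IsClosed (Dset f) :=
  isClosed_iInter fun _ => isClosed_iInter fun _ => isClosed_closure

lemma Dset_convex {f : X → ℝ} (hq : QuasiconvexFun f) : Convex ℝ (Dset f) :=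
  convex_iInter fun _ => convex_iInter fun _ => (qc_convex hq _).closure

lemma Dset_int_lt {f : X → ℝ} (hq : QuasiconvexFun f) {x : X} (hx : x ∈ interior (Dset f)) {q : ℚ}
    (h : (interior {x | f x < (q : ℝ)}).Nonempty) : f x < q := by
  have h1 : x ∈ interior (closure {x | f x < (q : ℝ)}) :=
    interior_mono (iInter₂_subset (s := fun (q : ℚ) (_ : (interior {x | f x < (q : ℝ)}).Nonempty) => closure {x | f x < (q : ℝ)}) q h) hx
  rw [(qc_convex hq _).interior_closure_eq_interior_of_nonempty_interior h] at h1
  exact interior_subset (s := {x | f x < (q : ℝ)}) h1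

lemma good_of_cont {f : X → ℝ} {x : X} (hx : ContinuousAt f x) {q : ℚ} (h : f x < q) :
    (interior {x | f x < (q : ℝ)}).Nonempty :=
  ⟨x, mem_interior_iff_mem_nhds.2 (hx.eventually_lt_const h)⟩

lemma int_le {f : X → ℝ} (hq : QuasiconvexFun f) {x0 x : X} (hc : ContinuousAt f x0)
    (hx : x ∈ interior (Dset f)) : f x ≤ f x0 := by
  by_contra hlt
  push Not at hlt
  obtain ⟨q, h1, h2⟩ := exists_rat_btwn hlt
  exact absurd (Dset_int_lt hq hx (good_of_cont hc h1)) (not_lt.2 h2.le)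

lemma Fn_int {f : X → ℝ} (hq : QuasiconvexFun f) (hd : DenselyContinuous f) {x0 : X}
    (hx : x0 ∈ interior (Dset f)) {c : ℝ} (hcc : c < f x0) : interior (closure {x | f x < c}) = ∅ := by
  by_contra hne
  obtain ⟨p, hp1, hp2⟩ := hd.inter_open_nonempty _ isOpen_interior (nonempty_iff_ne_empty.2 hne)
  have hpc : ContinuousAt f p := hp2
  have h1 : f p ≤ c := by
    by_contra hlt
    push Not at hlt
    have h2 := hpc.eventually_const_lt hlt
    obtain ⟨z, hz1, hz2⟩ := mem_closure_iff_nhds.1 (interior_subset hp1) _ h2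
    exact absurd (show f z < c from hz2) (not_lt.2 (le_of_lt (show c < f z from hz1)))
  obtain ⟨q, h3, h4⟩ := exists_rat_btwn hcc
  have := Dset_int_lt hq hx (good_of_cont hpc (h1.trans_lt h3))
  linarith

lemma ray_nowhere {C : Set X} (hC : IsClosed C) (hempt : interior C = ∅) (x : X) {σ : ℝ} (hσ : σ * σ = 1) (k : ℕ) :
    IsNowhereDense {h : Metric.sphere (0:X) 1 | ∀ t ∈ Icc ((1:ℝ)/(k+2)) (1/(k+1)), x + (σ * t) • (h : X) ∈ C} := by
  have hcl : IsClosed {h : Metric.sphere (0:X) 1 | ∀ t ∈ Icc ((1:ℝ)/(k+2)) (1/(k+1)), x + (σ * t) • (h : X) ∈ C} := by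
    simp only [setOf_forall]
    refine isClosed_iInter fun t => isClosed_iInter fun _ => hC.preimage ?_
    fun_prop
  rw [hcl.isNowhereDense_iff]
  by_contra hne
  obtain ⟨h0, hh0⟩ := nonempty_iff_ne_empty.2 hne
  rw [mem_interior_iff_mem_nhds, mem_nhds_subtype] at hh0
  obtain ⟨U, hU, hUN⟩ := hh0
  have hn0 : ‖(h0 : X)‖ = 1 := by simp
  have hσ1 : |σ| = 1 := by
    have : |σ| * |σ| = 1 := by rw [← abs_mul, hσ, abs_one]
    nlinarith [abs_nonneg σ]
  obtain ⟨t0, ht1, ht2⟩ : ∃ t0 : ℝ, 1/(k+2) < t0 ∧ t0 < 1/(k+1) :=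
    exists_between (by apply one_div_lt_one_div_of_lt <;> [positivity; linarith])
  have ht0 : 0 < t0 := lt_trans (by positivity) ht1
  set z0 := x + (σ * t0) • (h0 : X) with hz0
  have hnz : ‖z0 - x‖ = t0 := by
    rw [hz0, add_sub_cancel_left, norm_smul, hn0, mul_one, Real.norm_eq_abs, abs_mul, hσ1, one_mul, abs_of_pos ht0]
  have hψ : ContinuousAt (fun z : X => ‖z - x‖⁻¹ • (σ • (z - x))) z0 := by
    have : ContinuousAt (fun z : X => ‖z - x‖⁻¹) z0 := by
      apply ContinuousAt.inv₀ (by fun_prop)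
      rw [hnz]; exact ht0.ne'
    exact this.smul (by fun_prop)
  have hψ0 : ‖z0 - x‖⁻¹ • (σ • (z0 - x)) = (h0 : X) := by
    rw [hnz, hz0, add_sub_cancel_left, smul_smul, smul_smul]
    have : t0⁻¹ * (σ * (σ * t0)) = 1 := by
      rw [← mul_assoc σ, hσ, one_mul, inv_mul_cancel₀ ht0.ne']
    rw [mul_assoc, this, one_smul]
  have e1 : ∀ᶠ z in 𝓝 z0, ‖z - x‖⁻¹ • (σ • (z - x)) ∈ U := hψ.eventually_mem (by rw [hψ0]; exact hU)
  have hnc : ContinuousAt (fun z : X => ‖z - x‖) z0 := by fun_prop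
  have e2 : ∀ᶠ z in 𝓝 z0, ‖z - x‖ ∈ Ioo ((1:ℝ)/(k+2)) (1/(k+1)) :=
    hnc.eventually_mem (Ioo_mem_nhds (by rw [hnz]; exact ht1) (by rw [hnz]; exact ht2))
  have : z0 ∈ interior C := by
    rw [mem_interior_iff_mem_nhds]
    filter_upwards [e1, e2] with z hz1 hz2
    have hp : 0 < ‖z - x‖ := lt_trans (by positivity) hz2.1
    have hs : ‖z - x‖⁻¹ • (σ • (z - x)) ∈ Metric.sphere (0:X) 1 := by
      rw [mem_sphere_zero_iff_norm, norm_smul, norm_smul, Real.norm_eq_abs, Real.norm_eq_abs, hσ1, one_mul,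
        abs_of_pos (by positivity), inv_mul_cancel₀ hp.ne']
    have := hUN (a := ⟨_, hs⟩) hz1 ‖z - x‖ ⟨hz2.1.le, hz2.2.le⟩
    have e : x + (σ * ‖z - x‖) • (‖z - x‖⁻¹ • (σ • (z - x))) = z := by
      rw [smul_smul, smul_smul]
      have : σ * ‖z - x‖ * ‖z - x‖⁻¹ * σ = 1 := by
        rw [mul_assoc σ, mul_inv_cancel₀ hp.ne', mul_one, hσ]
      rw [this, one_smul]; abel
    simpa only [e] using this
  rw [hempt] at this
  exact this

lemma bad_dirs_meagre {f : X → ℝ} (hq : QuasiconvexFun f) {m : ℝ}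
    (hF : ∀ c < m, interior (closure {x | f x < c}) = ∅) (x : X) {σ : ℝ} (hσ : σ * σ = 1) :
    IsMeagre {h : Metric.sphere (0:X) 1 | ∃ δ > 0, ∀ t : ℝ, 0 < t → t < δ → f (x + (σ * t) • (h : X)) < m} := by
  have hsub : {h : Metric.sphere (0:X) 1 | ∃ δ > 0, ∀ t : ℝ, 0 < t → t < δ → f (x + (σ * t) • (h : X)) < m} ⊆
      ⋃ (p : ℕ × ℕ), {h : Metric.sphere (0:X) 1 | ∀ t ∈ Icc ((1:ℝ)/(p.1+2)) (1/(p.1+1)),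
        x + (σ * t) • (h : X) ∈ closure {x | f x < m - 1/(p.2+1)}} := by
    rintro h ⟨δ, hδ, hh⟩
    obtain ⟨k, hk⟩ := exists_nat_one_div_lt hδ
    have a1 : (0:ℝ) < 1/(k+2) := by positivity
    have a2 : (1:ℝ)/(k+2) < 1/(k+1) := by apply one_div_lt_one_div_of_lt <;> [positivity; linarith]
    have b1 := hh (1/(k+2)) a1 (a2.trans hk)
    have b2 := hh (1/(k+1)) (a1.trans a2) hk
    obtain ⟨n, hn⟩ := exists_nat_one_div_lt (sub_pos.2 (max_lt b1 b2))
    refine mem_iUnion.2 ⟨(k, n), fun t ht => subset_closure ?_⟩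
    have hcv2 := line_convex hq (m - 1/(n+1)) x (h : X) σ
    have c1 : (1:ℝ)/(k+2) ∈ {t : ℝ | f (x + (σ * t) • (h : X)) < m - 1/(n+1)} := by
      have := le_max_left (f (x + (σ * (1/(k+2))) • (h : X))) (f (x + (σ * (1/(k+1))) • (h : X)))
      simp only [mem_setOf_eq]
      linarith
    have c2 : (1:ℝ)/(k+1) ∈ {t : ℝ | f (x + (σ * t) • (h : X)) < m - 1/(n+1)} := by
      have := le_max_right (f (x + (σ * (1/(k+2))) • (h : X))) (f (x + (σ * (1/(k+1))) • (h : X)))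
      simp only [mem_setOf_eq]
      linarith
    exact hcv2.ordConnected.out c1 c2 ht
  refine IsMeagre.mono hsub ?_
  refine isMeagre_iUnion fun p => ?_
  exact (ray_nowhere isClosed_closure (hF _ (by have : (0:ℝ) < 1/(p.2+1) := by positivity
                                                linarith)) x hσ p.1).isMeagre

lemma good_dir {f : X → ℝ} (hq : QuasiconvexFun f) {m : ℝ} {x h : X} {σ : ℝ}
    (hn : ¬ ∃ δ > 0, ∀ t : ℝ, 0 < t → t < δ → f (x + (σ * t) • h) < m) :
    ∃ δ > 0, ∀ t : ℝ, 0 < t → t < δ → m ≤ f (x + (σ * t) • h) := by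
  by_contra hc
  push Not at hn hc
  have hcv2 := line_convex hq m x h σ
  obtain ⟨t1, h1, -, h1'⟩ := hc 1 one_pos
  obtain ⟨t2, h2, h21, h2'⟩ := hn t1 h1
  obtain ⟨t3, h3, h32, h3'⟩ := hc t2 h2
  exact absurd (hcv2.ordConnected.out h3' h1' ⟨h32.le, h21.le⟩) (not_lt.2 h2')

lemma inner_thm {f : X → ℝ} (hq : QuasiconvexFun f) {m : ℝ} {x : X} (hx : x ∈ interior (Dset f))
    (hm : ∀ y ∈ interior (Dset f), f y ≤ m)
    (hF : ∀ c < m, interior (closure {x | f x < c}) = ∅)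
    (hxF : ∀ n : ℕ, x ∉ closure {x | f x < m - 1/(n+1)}) : ContinuousAt f x ∧ EssGateauxDiffAt f x := by
  have hnear : ∀ᶠ y in 𝓝 x, f y ≤ m := by
    filter_upwards [isOpen_interior.mem_nhds hx] with y hy using hm y hy
  have hlow : ∀ ε > 0, ∀ᶠ y in 𝓝 x, m - ε < f y := by
    intro ε hε
    obtain ⟨n, hn⟩ := exists_nat_one_div_lt hε
    filter_upwards [isClosed_closure.isOpen_compl.mem_nhds (hxF n)] with y hy
    by_contra hlt
    exact hy (subset_closure (by show f y < _; linarith))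
  have hfx : f x = m := by
    refine le_antisymm (hm x hx) ?_
    by_contra hlt
    have := (hlow (m - f x) (by linarith)).self_of_nhds
    linarith
  refine ⟨?_, 0, {h | (¬ ∃ δ > 0, ∀ t : ℝ, 0 < t → t < δ → f (x + (1 * t) • (h : X)) < m) ∧
      (¬ ∃ δ > 0, ∀ t : ℝ, 0 < t → t < δ → f (x + (-1 * t) • (h : X)) < m)}, ?_, ?_⟩
  · rw [Metric.continuousAt_iff']
    intro ε hε
    filter_upwards [hnear, hlow ε hε] with y h1 h2
    rw [Real.dist_eq, hfx, abs_lt]; constructor <;> linarith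
  · refine IsMeagre.mono ?_ ((bad_dirs_meagre hq hF x (σ := 1) (by norm_num)).union
      (bad_dirs_meagre hq hF x (σ := -1) (by norm_num)))
    intro h hh
    by_contra hc
    rw [mem_union, not_or] at hc
    exact hh hc
  · rintro h ⟨h1, h2⟩
    obtain ⟨δ1, hδ1, k1⟩ := good_dir hq h1
    obtain ⟨δ2, hδ2, k2⟩ := good_dir hq h2
    have hct : Tendsto (fun t : ℝ => x + t • (h : X)) (𝓝[≠] 0) (𝓝 x) := by
      have : ContinuousAt (fun t : ℝ => x + t • (h : X)) 0 := by fun_prop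
      have h3 := this.tendsto
      simp only [zero_smul, add_zero] at h3
      exact h3.mono_left nhdsWithin_le_nhds
    refine tendsto_const_nhds.congr' (f₁ := fun _ => (0:ℝ)) ?_
    have hsm : ∀ᶠ t : ℝ in 𝓝[≠] 0, t ∈ Ioo (-δ2) δ1 :=
      nhdsWithin_le_nhds (Ioo_mem_nhds (by linarith) hδ1)
    filter_upwards [hct.eventually hnear, hsm, self_mem_nhdsWithin] with t ht1 ht2 ht3
    have : f (x + t • (h : X)) = m := by
      refine le_antisymm ht1 ?_
      rcases lt_or_gt_of_ne ht3 with h0 | h0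
      · have := k2 (-t) (by linarith) (by linarith [ht2.1])
        simpa using this
      · have := k1 t h0 ht2.2
        simpa using this
    rw [this, hfx]; simp

end intE


section frF
variable {X : Type*} [NormedAddCommGroup X] [NormedSpace ℝ X]

lemma frontier_thm [CompleteSpace X] [TopologicalSpace.SeparableSpace X] [MeasurableSpace X] [BorelSpace X]
    {D : Set X} (hc : IsClosed D) (hcv : Convex ℝ D) (hne : (interior D).Nonempty) :
    ∃ B : ℕ → Set X, (∀ n, MeasurableSet (B n)) ∧ (∀ n, FinDimNull (B n)) ∧
      ∀ y ∈ D, y ∉ interior D → ∃ n, y ∈ B n := by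
  obtain ⟨a, ha⟩ := hne
  obtain ⟨ρ, hρ, hb⟩ := Metric.mem_nhds_iff.1 (isOpen_interior.mem_nhds ha)
  refine ⟨fun i => (D \ interior D) ∩ Metric.ball (a + TopologicalSpace.denseSeq X i) ρ, fun n => ?_, fun i => ?_, ?_⟩
  · exact (hc.measurableSet.diff isOpen_interior.measurableSet).inter Metric.isOpen_ball.measurableSet
  · refine finDimNull_of_line (TopologicalSpace.denseSeq X i) fun x => ?_
    set v := TopologicalSpace.denseSeq X i
    have key : ∀ t t' : ℝ, t < t' → x + t • v ∈ (D \ interior D) ∩ Metric.ball (a + v) ρ →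
        x + t' • v ∈ (D \ interior D) ∩ Metric.ball (a + v) ρ → False := by
      intro t t' htt h1 h2
      apply h1.1.2
      have hp : x + t • v - v ∈ interior D := by
        apply hb
        have := h1.2
        rw [Metric.mem_ball, dist_eq_norm] at *
        have e : x + t • v - v - a = x + t • v - (a + v) := by abel
        rwa [e]
      set s := t' - t with hs
      have hs0 : 0 < s := by linarith
      have := hcv.combo_interior_self_mem_interior hp h2.1.1 (a := s / (1+s)) (b := 1/(1+s)) (by positivity) (by positivity)
        (by field_simp; ring)
      convert this using 1
      have ht' : t' = t + s := by rw [hs]; ring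
      rw [ht']
      have h0 : 1 + s ≠ 0 := by positivity
      match_scalars <;> field_simp <;> ring
    intro t ht t' ht'
    rcases lt_trichotomy t t' with h | h | h
    · exact (key t t' h ht ht').elim
    · exact h
    · exact (key t' t h ht' ht).elim
  · intro y hy hy2
    obtain ⟨_, hm, i, rfl⟩ := Metric.dense_iff.1 (TopologicalSpace.denseRange_denseSeq X) (y - a) ρ hρ
    refine ⟨i, ⟨hy, hy2⟩, ?_⟩
    rw [Metric.mem_ball, dist_eq_norm] at *
    rw [norm_sub_rev] at hm
    have e : y - (a + TopologicalSpace.denseSeq X i) = y - a - TopologicalSpace.denseSeq X i := by abel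
    rw [e]; exact hm

/-- adding the segment `[0,1] • e` -/
def addSeg (C : Set X) (e : X) : Set X := {x | ∃ c ∈ C, ∃ t ∈ Icc (0:ℝ) 1, x = c + t • e}

lemma subset_addSeg (C : Set X) (e : X) : C ⊆ addSeg C e := fun c hc => ⟨c, hc, 0, by simp, by simp⟩

lemma addSeg_convex {C : Set X} (hC : Convex ℝ C) (e : X) : Convex ℝ (addSeg C e) := by
  rintro x ⟨c, hc, t, ht, rfl⟩ y ⟨d, hd, s, hs, rfl⟩ a b ha hb hab
  refine ⟨a • c + b • d, hC hc hd ha hb hab, a • t + b • s, convex_Icc (0:ℝ) 1 ht hs ha hb hab, ?_⟩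
  simp only [smul_eq_mul]
  module

lemma addSeg_closed {C : Set X} (hC : IsClosed C) (e : X) : IsClosed (addSeg C e) := by
  have hK : IsCompact ((fun t : ℝ => t • e) '' Icc (0:ℝ) 1) := isCompact_Icc.image (by fun_prop)
  have := hC.add_right_of_isCompact hK
  convert this using 1
  ext x
  simp only [addSeg, Set.mem_add, mem_setOf_eq, mem_image]
  constructor
  · rintro ⟨c, hc, t, ht, rfl⟩; exact ⟨c, hc, _, ⟨t, ht, rfl⟩, rfl⟩
  · rintro ⟨c, hc, _, ⟨t, ht, rfl⟩, rfl⟩; exact ⟨c, hc, t, ht, rfl⟩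

lemma addSeg_step {C : Set X} (hC : Convex ℝ C) (e : X) (hi : (interior (addSeg C e)).Nonempty) :
    (interior C).Nonempty ∨ ∀ x, {t : ℝ | x + t • e ∈ C}.Subsingleton := by
  by_cases h : ∀ x, {t : ℝ | x + t • e ∈ C}.Subsingleton
  · exact Or.inr h
  left
  obtain ⟨c, τ, hτ, hc, hc'⟩ : ∃ (c : X) (τ : ℝ), 0 < τ ∧ c ∈ C ∧ c + τ • e ∈ C := by
    simp only [Set.Subsingleton, not_forall] at h
    obtain ⟨x, s, hs, t, ht, hne⟩ := h
    rcases lt_or_gt_of_ne hne with h0 | h0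
    · refine ⟨x + s • e, t - s, by linarith, hs, ?_⟩
      have e1 : x + s • e + (t - s) • e = x + t • e := by module
      rw [e1]; exact ht
    · refine ⟨x + t • e, s - t, by linarith, ht, ?_⟩
      have e1 : x + t • e + (s - t) • e = x + s • e := by module
      rw [e1]; exact hs
  obtain ⟨u, hu⟩ := hi
  have hpos : 0 < 1 + τ := by linarith
  have hmap : ∀ z ∈ addSeg C e, (τ / (1+τ)) • z + (1/(1+τ)) • c ∈ C := by
    rintro z ⟨c1, hc1, t, ht, rfl⟩
    have h1 : c + (t * τ) • e ∈ C := by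
      have := hC hc hc' (a := 1 - t) (b := t) (by linarith [ht.2]) ht.1 (by ring)
      convert this using 1
      module
    have := hC hc1 h1 (a := τ/(1+τ)) (b := 1/(1+τ)) (by positivity) (by positivity) (by field_simp; ring)
    convert this using 1
    match_scalars <;> field_simp
  have hct : ContinuousAt (fun w : X => ((1+τ)/τ) • (w - (1/(1+τ)) • c)) ((τ / (1+τ)) • u + (1/(1+τ)) • c) := by fun_prop
  have h0 : ((1+τ)/τ) * (τ/(1+τ)) = 1 := by field_simp
  refine ⟨(τ / (1+τ)) • u + (1/(1+τ)) • c, mem_interior_iff_mem_nhds.2 ?_⟩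
  have hev := hct.eventually_mem (s := addSeg C e) (by
    rw [add_sub_cancel_right, smul_smul, h0, one_smul]
    exact mem_interior_iff_mem_nhds.1 hu)
  filter_upwards [hev] with w hw
  have := hmap _ hw
  have h1 : (τ/(1+τ)) * ((1+τ)/τ) = 1 := by rw [mul_comm, h0]
  rwa [smul_smul, h1, one_smul, sub_add_cancel] at this

/-- iterated segments -/
def addBox (C : Set X) : List X → Set X
  | [] => C
  | k :: l => addSeg (addBox C l) k

lemma addBox_convex {C : Set X} (hC : Convex ℝ C) (l : List X) : Convex ℝ (addBox C l) := by
  induction l with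
  | nil => exact hC
  | cons k l ih => exact addSeg_convex ih k

lemma addBox_closed {C : Set X} (hC : IsClosed C) (l : List X) : IsClosed (addBox C l) := by
  induction l with
  | nil => exact hC
  | cons k l ih => exact addSeg_closed ih k

lemma subset_addBox (C : Set X) (l : List X) : C ⊆ addBox C l := by
  induction l with
  | nil => exact fun _ h => h
  | cons k l ih => exact ih.trans (subset_addSeg _ _)

lemma mem_addBox {C : Set X} {l : List X} {c k : X} (hc : c ∈ C) (hk : k ∈ l) : c + k ∈ addBox C l := by
  induction l with
  | nil => simp at hk
  | cons k' l ih =>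
    rcases List.mem_cons.1 hk with rfl | h
    · exact ⟨c, subset_addBox C l hc, 1, by simp, by simp⟩
    · exact subset_addSeg _ _ (ih h)

lemma addBox_int {C : Set X} (hC : Convex ℝ C) (l : List X) (hi : (interior (addBox C l)).Nonempty) :
    (interior C).Nonempty ∨ ∃ v, ∀ x, {t : ℝ | x + t • v ∈ C}.Subsingleton := by
  induction l with
  | nil => exact Or.inl hi
  | cons k l ih =>
    rcases addSeg_step (addBox_convex hC l) k hi with h | h
    · exact ih h
    · exact Or.inr ⟨k, fun x => (h x).anti fun t ht => subset_addBox C l ht⟩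

lemma ball_subset_of_approx {T : Set X} (hT : IsClosed T) (hcv : Convex ℝ T) {r : ℝ} (hr : 0 < r)
    (h : ∀ y, ‖y‖ ≤ r → ∃ t ∈ T, ‖y - t‖ ≤ r / 2) : Metric.ball (0:X) (r/2) ⊆ T := by
  intro x hx
  by_contra hxT
  rw [mem_ball_zero_iff] at hx
  obtain ⟨l, u, h1, h2⟩ := geometric_hahn_banach_closed_point hcv hT hxT
  have hb : ∀ y, ‖y‖ ≤ r → l y ≤ u + ‖l‖ * (r/2) := by
    intro y hy
    obtain ⟨t, ht, hyt⟩ := h y hy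
    have e : l y = l t + l (y - t) := by rw [map_sub]; ring
    have h3 : l (y - t) ≤ ‖l‖ * (r/2) :=
      (le_abs_self _).trans ((l.le_opNorm _).trans (by gcongr))
    linarith [h1 t ht]
  have hn : ‖l‖ ≤ (u + ‖l‖ * (r/2)) / r := by
    refine ContinuousLinearMap.opNorm_bound_of_ball_bound hr _ l fun z hz => ?_
    rw [mem_closedBall_zero_iff] at hz
    rw [Real.norm_eq_abs, abs_le]
    have := hb (-z) (by rwa [norm_neg])
    rw [map_neg] at this
    exact ⟨by linarith, hb z hz⟩
  rw [le_div_iff₀ hr] at hn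
  have h3 : l x ≤ ‖l‖ * (r/2) := (le_abs_self _).trans ((l.le_opNorm _).trans (by gcongr))
  linarith

/-- if a closed convex set plus a compact set covers a ball, the set has interior or is flat -/
lemma flat_of_cover {C K : Set X} (hC : IsClosed C) (hcv : Convex ℝ C) (hK : IsCompact K) {r : ℝ} (hr : 0 < r)
    (h : ∀ y, ‖y‖ ≤ r → ∃ k ∈ K, k + y ∈ C) :
    (interior C).Nonempty ∨ ∃ v, ∀ x, {t : ℝ | x + t • v ∈ C}.Subsingleton := by
  obtain ⟨s, hsK, hs⟩ := hK.elim_nhds_subcover (fun k => Metric.ball k (r/2)) (fun k _ => Metric.ball_mem_nhds k (half_pos hr))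
  refine addBox_int hcv (s.toList.map fun k => -k) ?_
  have := ball_subset_of_approx (addBox_closed hC (s.toList.map fun k => -k)) (addBox_convex hcv _) hr (by
    intro y hy
    obtain ⟨k, hk, hky⟩ := h y hy
    obtain ⟨k', hk', hkk⟩ := mem_iUnion₂.1 (hs hk)
    refine ⟨(k + y) + (-k'), mem_addBox hky (by simpa using hk'), ?_⟩
    rw [Metric.mem_ball, dist_eq_norm] at hkk
    have e : y - (k + y + -k') = -(k - k') := by abel
    rw [e, norm_neg]; exact hkk.le)
  exact ⟨0, mem_interior_iff_mem_nhds.2 (mem_of_superset (Metric.ball_mem_nhds 0 (half_pos hr)) this)⟩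

end frF


section minimaxG

variable {T : Type*} [TopologicalSpace T] [MeasurableSpace T] [BorelSpace T]

lemma closed_mass [TopologicalSpace.MetrizableSpace T] {S : Set T} (hS : IsClosed S) (δ : ℝ) :
    IsClosed {ν : ProbabilityMeasure T | δ ≤ (ν : Measure T).real S} := by
  have e : {ν : ProbabilityMeasure T | δ ≤ (ν : Measure T).real S} = {ν : ProbabilityMeasure T | ENNReal.ofReal δ ≤ (ν : Measure T) S} := by
    ext ν
    simp only [mem_setOf_eq, Measure.real]
    rw [ENNReal.ofReal_le_iff_le_toReal (measure_ne_top _ _)]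
  rw [e]
  refine isClosed_of_closure_subset fun ν hν => ?_
  rw [mem_closure_iff_nhdsWithin_neBot] at hν
  have ht : Tendsto (fun μ : ProbabilityMeasure T => μ) (𝓝[{ν : ProbabilityMeasure T | ENNReal.ofReal δ ≤ (ν : Measure T) S}] ν) (𝓝 ν) :=
    nhdsWithin_le_nhds
  have h1 := ProbabilityMeasure.limsup_measure_closed_le_of_tendsto ht hS
  refine le_trans ?_ h1
  refine le_limsup_of_frequently_le (Eventually.frequently ?_) (by isBoundedDefault)
  exact self_mem_nhdsWithin

lemma finite_minimax [Nonempty T] {I : Type*} [Fintype I] {S : I → Set T} (hS : ∀ i, MeasurableSet (S i))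
    (δ : ℝ) 
    (h : ∀ c : I → ℝ, (∀ i, 0 ≤ c i) → ∑ i, c i = 1 → ∃ x, δ ≤ ∑ i, c i * (S i).indicator (fun _ => (1:ℝ)) x) :
    ∃ ν : Measure T, IsProbabilityMeasure ν ∧ ∀ i, δ ≤ ν.real (S i) := by
  classical
  let a : T → (I → ℝ) := fun x i => (S i).indicator (fun _ => (1:ℝ)) x
  have hfin : (range a).Finite := by
    refine (Set.Finite.pi (ι := I) (t := fun _ => ({0, 1} : Set ℝ)) fun _ => by simp).subset ?_
    rintro _ ⟨x, rfl⟩ i -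
    by_cases hx : x ∈ S i <;> simp [a, hx]
  let P : Set (I → ℝ) := {p | ∃ ν : Measure T, IsProbabilityMeasure ν ∧ ∀ i, p i = ν.real (S i)}
  have hP : Convex ℝ P := by
    rintro p ⟨ν, hν, hp⟩ q ⟨μ, hμ, hq⟩ s t hs ht hst
    refine ⟨ENNReal.ofReal s • ν + ENNReal.ofReal t • μ, ⟨?_⟩, fun i => ?_⟩
    · simp [← ENNReal.ofReal_add hs ht, hst]
    · rw [measureReal_add_apply (by simp [ENNReal.mul_eq_top]) (by simp [ENNReal.mul_eq_top])]
      simp [hp, hq, measureReal_ennreal_smul_apply, hs, ht]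
  have hsub : convexHull ℝ (range a) ⊆ P := by
    refine convexHull_min ?_ hP
    rintro _ ⟨x, rfl⟩
    refine ⟨Measure.dirac x, inferInstance, fun i => ?_⟩
    simp only [Measure.real, Measure.dirac_apply' x (hS i), a]
    by_cases hx : x ∈ S i <;> simp [hx]
  let Q : Set (I → ℝ) := {p | ∀ i, δ ≤ p i}
  by_contra hno
  have hdisj : Disjoint (convexHull ℝ (range a)) Q := by
    rw [Set.disjoint_left]
    intro p hp hq
    obtain ⟨ν, hν, hpν⟩ := hsub hp
    exact hno ⟨ν, hν, fun i => (hpν i) ▸ hq i⟩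
  have hQc : Convex ℝ Q := by
    intro p hp q hq s t hs ht hst i
    have h1 := hp i
    have h2 := hq i
    simp only [Pi.add_apply, Pi.smul_apply, smul_eq_mul]
    have : t = 1 - s := by linarith
    subst this
    nlinarith
  have hQcl : IsClosed Q := by
    simp only [Q, setOf_forall]
    exact isClosed_iInter fun i => isClosed_le continuous_const (continuous_apply i)
  obtain ⟨f, u, w, h1, h2, h3⟩ := geometric_hahn_banach_compact_closed (convex_convexHull ℝ (range a))
    (hfin.isCompact_convexHull (𝕜 := ℝ)) hQc hQcl hdisj
  let c : I → ℝ := fun i => f (fun j => if i = j then 1 else 0)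
  have hf : ∀ p, f p = ∑ i, p i * c i := by
    intro p
    have := (f : (I → ℝ) →ₗ[ℝ] ℝ).pi_apply_eq_sum_univ p
    simpa [c] using this
  have hδf : w < ∑ i, δ * c i := by
    have := h3 (fun _ => δ) (fun _ => le_rfl)
    rwa [hf] at this
  have hc : ∀ i, 0 ≤ c i := by
    intro i
    by_contra hneg
    push Not at hneg
    set D := ∑ i, δ * c i
    have hk : ∀ n : ℝ, 0 ≤ n → w < D + n * c i := by
      intro n hn
      have := h3 (fun j => δ + (if i = j then n else 0)) (fun j => by
        simp only [Q]; split_ifs <;> linarith)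
      rw [hf] at this
      simp only [add_mul, Finset.sum_add_distrib, ite_mul, zero_mul, Finset.sum_ite_eq, Finset.mem_univ, if_true] at this
      exact this
    have := hk ((D - w) / (- c i)) (div_nonneg (by linarith) (by linarith))
    have e : (D - w) / (- c i) * c i = -(D - w) := by
      rw [div_neg, neg_mul, div_mul_cancel₀ _ hneg.ne]
    rw [e] at this
    linarith
  obtain ⟨x0⟩ := ‹Nonempty T›
  set σ := ∑ i, c i with hσ
  have hσ0 : 0 < σ := by
    refine lt_of_le_of_ne (Finset.sum_nonneg fun i _ => hc i) fun h0 => ?_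
    have hz : ∀ i, c i = 0 := fun i => (Finset.sum_eq_zero_iff_of_nonneg (fun i _ => hc i)).1 h0.symm i (Finset.mem_univ i)
    have k1 := h1 (a x0) (subset_convexHull ℝ _ ⟨x0, rfl⟩)
    rw [hf] at k1
    simp [hz] at k1 hδf
    linarith
  obtain ⟨x, hx⟩ := h (fun i => c i / σ) (fun i => div_nonneg (hc i) hσ0.le) (by
    rw [← Finset.sum_div]; exact div_self hσ0.ne')
  have k1 := h1 (a x) (subset_convexHull ℝ _ ⟨x, rfl⟩)
  rw [hf] at k1
  have e : ∑ i, c i / σ * (S i).indicator (fun _ => (1:ℝ)) x = (∑ i, a x i * c i) / σ := by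
    rw [Finset.sum_div]
    refine Finset.sum_congr rfl fun i _ => ?_
    simp only [a]; ring
  rw [e, le_div_iff₀ hσ0] at hx
  rw [← Finset.mul_sum] at hδf
  linarith

lemma minimax_measure [TopologicalSpace.MetrizableSpace T] [CompactSpace T] [Nonempty T] {I : Type*} {S : I → Set T}
    (hS : ∀ i, IsClosed (S i)) (δ : ℝ)
    (h : ∀ (Y : Finset I) (c : Y → ℝ), (∀ i, 0 ≤ c i) → ∑ i, c i = 1 →
      ∃ x, δ ≤ ∑ i : Y, c i * (S i).indicator (fun _ => (1:ℝ)) x) :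
    ∃ ν : Measure T, IsProbabilityMeasure ν ∧ ∀ i, δ ≤ ν.real (S i) := by
  have key : (⋂ i, {ν : ProbabilityMeasure T | δ ≤ (ν : Measure T).real (S i)}).Nonempty := by
    refine CompactSpace.iInter_nonempty (fun i => closed_mass (hS i) δ) fun Y => ?_
    obtain ⟨ν, hν, hh⟩ := finite_minimax (I := Y) (S := fun i => S i) (fun i => (hS i).measurableSet) δ (h Y)
    exact ⟨⟨ν, hν⟩, mem_iInter₂.2 fun i hi => hh ⟨i, hi⟩⟩
  obtain ⟨ν, hν⟩ := key
  exact ⟨ν, inferInstance, fun i => mem_iInter.1 hν i⟩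

end minimaxG


section lemH

variable {X : Type*} [NormedAddCommGroup X] [NormedSpace ℝ X]

lemma J_compact (hR : IsReflexiveSpace X) (l : ℕ → StrongDual ℝ X) {C : Set X} (hC : IsClosed C)
    (hcv : Convex ℝ C) {R : ℝ} (hb : ∀ x ∈ C, ‖x‖ ≤ R) :
    IsCompact ((fun (x : X) (k : ℕ) => l k x) '' C) := by
  let W : Set (WeakDual ℝ (StrongDual ℝ X)) := (WeakDual.toStrongDual ⁻¹' Metric.closedBall 0 R) ∩
    ⋂ (g : StrongDual ℝ X) (c : ℝ) (_ : ∀ x ∈ C, g x ≤ c), {ξ | ξ g ≤ c}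
  have hW : IsCompact W := by
    refine (WeakDual.isCompact_closedBall 0 R).inter_right ?_
    refine isClosed_iInter fun g => isClosed_iInter fun c => isClosed_iInter fun _ => ?_
    exact isClosed_le (WeakDual.eval_continuous g) continuous_const
  have hcont : Continuous (fun (ξ : WeakDual ℝ (StrongDual ℝ X)) (k : ℕ) => ξ (l k)) :=
    continuous_pi fun k => WeakDual.eval_continuous (l k)
  have e : (fun (x : X) (k : ℕ) => l k x) '' C
      = (fun (ξ : WeakDual ℝ (StrongDual ℝ X)) (k : ℕ) => ξ (l k)) '' W := by
    ext p
    constructor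
    · rintro ⟨x, hx, rfl⟩
      refine ⟨StrongDual.toWeakDual (NormedSpace.inclusionInDoubleDual ℝ X x), ⟨?_, ?_⟩, ?_⟩
      · have h9 : NormedSpace.inclusionInDoubleDual ℝ X x ∈ Metric.closedBall (0 : StrongDual ℝ (StrongDual ℝ X)) R := by
          refine (mem_closedBall_zero_iff (E := StrongDual ℝ (StrongDual ℝ X))).2 ?_
          exact (NormedSpace.double_dual_bound ℝ X x).trans (hb x hx)
        exact h9
      · simp only [mem_iInter]
        intro g c hg
        exact hg x hx
      · rfl
    · rintro ⟨ξ, ⟨-, h2⟩, rfl⟩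
      obtain ⟨x, hx⟩ := hR (WeakDual.toStrongDual ξ)
      have hxg : ∀ g : StrongDual ℝ X, ξ g = g x := by
        intro g
        have := congrArg (fun T : StrongDual ℝ (StrongDual ℝ X) => T g) hx
        exact this.symm
      refine ⟨x, ?_, ?_⟩
      · by_contra hxC
        obtain ⟨g, u, h3, h4⟩ := geometric_hahn_banach_closed_point hcv hC hxC
        simp only [mem_iInter] at h2
        have := h2 g u fun a ha => (h3 a ha).le
        rw [mem_setOf_eq, hxg] at this
        linarith
      · funext k
        exact (hxg (l k)).symm
  rw [e]
  exact hW.image hcont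

lemma exists_sep [TopologicalSpace.SeparableSpace X] : ∃ l : ℕ → StrongDual ℝ X,
    Function.Injective (fun (x : X) (k : ℕ) => l k x) := by
  choose g hg1 hg2 using fun x : X => exists_dual_vector'' ℝ x
  refine ⟨fun k => g (TopologicalSpace.denseSeq X k), fun x y hxy => ?_⟩
  have h0 : ∀ k, g (TopologicalSpace.denseSeq X k) (x - y) = 0 := by
    intro k
    rw [map_sub, sub_eq_zero]
    exact congrFun hxy k
  by_contra hne
  have hpos : 0 < ‖x - y‖ := norm_pos_iff.2 (sub_ne_zero.2 hne)
  obtain ⟨k, hk⟩ := (TopologicalSpace.denseRange_denseSeq X).exists_dist_lt (x - y) (half_pos hpos)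
  set d := TopologicalSpace.denseSeq X k
  have h1 : ‖d‖ ≤ ‖x - y - d‖ := by
    have h2 : g d d = - g d (x - y - d) := by rw [map_sub, h0 k]; ring
    have h3 : g d d = ‖d‖ := by simpa using hg2 d
    have h4 : |g d (x - y - d)| ≤ ‖x - y - d‖ := by
      have := (g d).le_opNorm (x - y - d)
      rw [Real.norm_eq_abs] at this
      nlinarith [hg1 d, norm_nonneg (x - y - d)]
    have := neg_abs_le (g d (x - y - d))
    linarith
  have h2 : ‖x - y‖ ≤ ‖x - y - d‖ + ‖d‖ := by
    simpa using norm_add_le (x - y - d) d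
  rw [dist_eq_norm] at hk
  linarith

variable [CompleteSpace X] [TopologicalSpace.SeparableSpace X] [MeasurableSpace X] [BorelSpace X]

lemma lemma_H (hR : IsReflexiveSpace X) {C : Set X} (hC : IsClosed C) (hcv : Convex ℝ C)
    {M : ℝ} (hb : ∀ x ∈ C, ‖x‖ ≤ M) (hempt : interior C = ∅) : SmallNull C := by
  classical
  intro r hr δ hδ
  by_contra hno
  push Not at hno
  have hfd : SecondCountableTopology X := inferInstance
  have hpol : PolishSpace X := inferInstance
  obtain ⟨l, hinj⟩ := exists_sep (X := X)
  set J : X → (ℕ → ℝ) := fun x k => l k x with hJ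
  have hJc : Continuous J := continuous_pi fun k => (l k).continuous
  have hJm : MeasurableEmbedding J := hJc.measurableEmbedding hinj
  have hM : 0 ≤ M := by
    obtain ⟨x, hx⟩ := hno (Measure.dirac 0) inferInstance (by simp [hr.le])
    rcases C.eq_empty_or_nonempty with h0 | ⟨c, hc⟩
    · simp [h0] at hx
    · exact (norm_nonneg c).trans (hb c hc)
  set K : Set X := Metric.closedBall 0 (M + r) with hK
  have hKcomp : IsCompact (J '' K) := J_compact hR l Metric.isClosed_closedBall (convex_closedBall 0 _)
    (fun x hx => mem_closedBall_zero_iff.1 hx)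
  have : CompactSpace (J '' K) := isCompact_iff_compactSpace.1 hKcomp
  have : Nonempty (J '' K) := ⟨⟨J 0, 0, by simp [K]; linarith, rfl⟩⟩
  let Sx : X → Set X := fun y => {x | x ∈ K ∧ x + y ∈ C}
  let S : Metric.closedBall (0:X) r → Set (J '' K) := fun y => Subtype.val ⁻¹' (J '' (Sx y))
  have hδ1 : δ ≠ ⊤ := by
    rintro rfl
    obtain ⟨x, hx⟩ := hno (Measure.dirac 0) inferInstance (by simp [hr.le])
    exact not_top_lt hx
  have hS : ∀ y, IsClosed (S y) := by
    intro y
    refine IsClosed.preimage continuous_subtype_val (IsCompact.isClosed ?_)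
    refine J_compact hR l (R := M + r) ?_ ?_ fun x hx => mem_closedBall_zero_iff.1 hx.1
    · exact Metric.isClosed_closedBall.inter (hC.preimage (continuous_id.add continuous_const))
    · refine (convex_closedBall (0:X) (M + r)).inter ?_
      exact hcv.translate_preimage_left _
  have hmain : ∀ (Y : Finset (Metric.closedBall (0:X) r)) (c : Y → ℝ), (∀ i, 0 ≤ c i) → ∑ i, c i = 1 →
      ∃ x, δ.toReal ≤ ∑ i : Y, c i * (S i).indicator (fun _ => (1:ℝ)) x := by
    intro Y c hc hs
    let μ : Measure X := ∑ i : Y, ENNReal.ofReal (c i) • Measure.dirac ((i : Metric.closedBall (0:X) r) : X)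
    have hμ : IsProbabilityMeasure μ := ⟨by
      simp [μ, ← ENNReal.ofReal_sum_of_nonneg (fun i _ => hc i)]
      rw [← hs]; rfl⟩
    have hμA : ∀ A : Set X, MeasurableSet A → μ A = ENNReal.ofReal (∑ i : Y, c i * A.indicator (fun _ => (1:ℝ)) ((i : Metric.closedBall (0:X) r) : X)) := by
      intro A hA
      rw [ENNReal.ofReal_sum_of_nonneg]
      · simp only [μ, Measure.coe_finset_sum, Finset.sum_apply, Measure.smul_apply, smul_eq_mul,
          Measure.dirac_apply' _ hA]
        refine Finset.sum_congr rfl fun i _ => ?_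
        by_cases hi : ((i : Metric.closedBall (0:X) r) : X) ∈ A <;> simp [hi]
      · intro i _
        exact mul_nonneg (hc i) (indicator_nonneg (by simp) _)
    obtain ⟨x, hx⟩ := hno μ hμ (by
      rw [hμA _ Metric.isClosed_closedBall.measurableSet.compl]
      rw [ENNReal.ofReal_eq_zero]
      apply le_of_eq
      refine Finset.sum_eq_zero fun i _ => ?_
      have := i.1.2
      simp only [indicator_of_notMem (show _ ∉ (Metric.closedBall (0:X) r)ᶜ from not_not.2 this), mul_zero])
    rw [hμA {y | x + y ∈ C} ((hC.preimage (continuous_const.add continuous_id)).measurableSet)] at hx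
    have hxK : x ∈ K := by
      by_contra hxK
      have : ∑ i : Y, c i * {y | x + y ∈ C}.indicator (fun _ => (1:ℝ)) ((i : Metric.closedBall (0:X) r) : X) = 0 := by
        refine Finset.sum_eq_zero fun i _ => ?_
        rw [indicator_of_notMem, mul_zero]
        intro h
        apply hxK
        have h1 := hb _ h
        have h2 := mem_closedBall_zero_iff.1 i.1.2
        rw [hK, mem_closedBall_zero_iff]
        have h3 := norm_sub_le (x + (i.1.1 : X)) (i.1.1 : X)
        rw [add_sub_cancel_right] at h3
        linarith
      change δ < ENNReal.ofReal (∑ i : Y, c i * {y | x + y ∈ C}.indicator (fun _ => (1:ℝ)) ((i : Metric.closedBall (0:X) r) : X)) at hx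
      rw [this] at hx
      simp at hx
    refine ⟨⟨J x, x, hxK, rfl⟩, ?_⟩
    have h1 := (ENNReal.lt_ofReal_iff_toReal_lt hδ1).1 hx
    refine h1.le.trans (le_of_eq ?_)
    refine Finset.sum_congr rfl fun i _ => ?_
    congr 1
    have : (i.1.1 ∈ (fun y => x + y) ⁻¹' C) ↔ (⟨J x, x, hxK, rfl⟩ : J '' K) ∈ S i := by
      simp only [S, Sx, mem_preimage]
      rw [hinj.mem_set_image]
      simp [hxK]
    by_cases hi : (⟨J x, x, hxK, rfl⟩ : J '' K) ∈ S i
    · rw [indicator_of_mem hi]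
      exact indicator_of_mem (this.2 hi) _
    · rw [indicator_of_notMem hi]
      exact indicator_of_notMem (fun h => hi (this.1 h)) _
  obtain ⟨ν, hν, hνS⟩ := minimax_measure hS δ.toReal hmain
  let ν₁ : Measure (ℕ → ℝ) := ν.map Subtype.val
  let ν₂ : Measure X := ν₁.comap J
  have hν₁ : IsProbabilityMeasure ν₁ := Measure.isProbabilityMeasure_map measurable_subtype_coe.aemeasurable
  have hν₂a : ∀ A, ν₂ A = ν₁ (J '' A) := fun A => hJm.comap_apply _ _
  have hν₂ : IsFiniteMeasure ν₂ := ⟨by rw [hν₂a]; exact measure_lt_top _ _⟩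
  have hbig : ∀ y : X, ‖y‖ ≤ r → δ ≤ ν₂ {x | x + y ∈ C} := by
    intro y hy
    have h1 := hνS ⟨y, mem_closedBall_zero_iff.2 hy⟩
    rw [Measure.real, ENNReal.toReal_le_toReal hδ1 (measure_ne_top _ _)] at h1
    refine h1.trans ?_
    rw [hν₂a]
    refine le_trans ?_ (Measure.le_map_apply measurable_subtype_coe.aemeasurable _)
    refine measure_mono ?_
    refine preimage_mono (image_mono ?_)
    intro x hx
    exact hx.2
  have htight : IsTightMeasureSet {ν₂} := isTightMeasureSet_singleton
  obtain ⟨K0, hK0, hK0'⟩ := isTightMeasureSet_iff_exists_isCompact_measure_compl_le.1 htight (δ / 2)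
    (ENNReal.half_pos hδ.ne')
  have hlt : ν₂ K0ᶜ < δ := (hK0' _ rfl).trans_lt (ENNReal.half_lt_self hδ.ne' hδ1)
  have hcov : ∀ y, ‖y‖ ≤ r → ∃ k ∈ K0, k + y ∈ C := by
    intro y hy
    by_contra hcon
    push Not at hcon
    have : ν₂ {x | x + y ∈ C} ≤ ν₂ K0ᶜ := measure_mono fun x hx hxk => hcon x hxk hx
    exact absurd (this.trans_lt hlt) (not_lt.2 (hbig y hy))
  rcases flat_of_cover hC hcv hK0 hr hcov with h | ⟨v, hv⟩
  · rw [hempt] at h; exact not_nonempty_empty h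
  · obtain ⟨μ, h1, h2, h3⟩ := (finDimNull_of_line v hv).smallNull hC.measurableSet r hr δ hδ
    obtain ⟨x, hx⟩ := hno μ h1 h2
    exact absurd (h3 x) (not_le.2 hx)

end lemH


section finalI

variable {X : Type*} [NormedAddCommGroup X] [NormedSpace ℝ X] [CompleteSpace X]
    [TopologicalSpace.SeparableSpace X] [MeasurableSpace X] [BorelSpace X]

/-- `E` is covered by countably many Borel sets that are `SmallNull`. -/
def SNCover (E : Set X) : Prop :=
  ∃ B : ℕ → Set X, (∀ n, MeasurableSet (B n)) ∧ (∀ n, SmallNull (B n)) ∧ E ⊆ ⋃ n, B n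

lemma smallNull_empty : SmallNull (∅ : Set X) := by
  intro r hr δ hδ
  exact ⟨Measure.dirac 0, inferInstance, by simp [hr.le], by simp⟩

lemma SNCover.mono {E F : Set X} (h : E ⊆ F) (hF : SNCover F) : SNCover E := by
  obtain ⟨B, h1, h2, h3⟩ := hF
  exact ⟨B, h1, h2, h.trans h3⟩

lemma SNCover.of_family {ι : Type*} [Countable ι] (B : ι → Set X) (h1 : ∀ n, MeasurableSet (B n))
    (h2 : ∀ n, SmallNull (B n)) : SNCover (⋃ n, B n) := by
  obtain ⟨g, hg⟩ := exists_surjective_nat (Option ι)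
  refine ⟨fun n => (g n).elim ∅ B, fun n => ?_, fun n => ?_, ?_⟩
  · change MeasurableSet ((g n).elim ∅ B)
    cases g n <;> simp [h1]
  · change SmallNull ((g n).elim ∅ B)
    cases g n
    · exact smallNull_empty
    · exact h2 _
  · refine iUnion_subset fun i => ?_
    obtain ⟨n, hn⟩ := hg (some i)
    intro x hx
    exact mem_iUnion.2 ⟨n, by simpa [hn] using hx⟩

lemma SNCover.iUnion {ι : Type*} [Countable ι] {E : ι → Set X} (h : ∀ i, SNCover (E i)) :
    SNCover (⋃ i, E i) := by
  choose B h1 h2 h3 using h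
  refine SNCover.mono ?_ (SNCover.of_family (fun p : ι × ℕ => B p.1 p.2) (fun p => h1 _ _) (fun p => h2 _ _))
  refine iUnion_subset fun i x hx => ?_
  obtain ⟨n, hn⟩ := mem_iUnion.1 (h3 i hx)
  exact mem_iUnion.2 ⟨(i, n), hn⟩

lemma SNCover.union {E F : Set X} (h : SNCover E) (h' : SNCover F) : SNCover (E ∪ F) := by
  rw [union_eq_iUnion]
  exact SNCover.iUnion fun b => by cases b <;> assumption

lemma SNCover.haarNull {E : Set X} (h : SNCover E) : HaarNull E := by
  obtain ⟨B, h1, h2, h3⟩ := h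
  exact ⟨⋃ n, B n, h3, MeasurableSet.iUnion h1, combine_smallNull B h1 h2⟩

lemma outer_cover {f : X → ℝ} (hq : QuasiconvexFun f) :
    SNCover {x | x ∉ Dset f ∧ ¬ (ContinuousAt f x ∧ EssGateauxDiffAt f x)} := by
  have h : ∀ q : ℚ, SNCover {x | (interior {x | f x < (q:ℝ)}).Nonempty ∧ x ∉ closure {x | f x < (q:ℝ)} ∧
      ¬ (ContinuousAt f x ∧ EssGateauxDiffAt f x)} := by
    intro q
    by_cases hne : (interior {x | f x < (q:ℝ)}).Nonempty
    · obtain ⟨B, h1, h2, h3⟩ := outer_thm hq q hne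
      refine SNCover.mono ?_ (SNCover.of_family B h1 fun n => (h2 n).smallNull (h1 n))
      rintro y ⟨-, hy1, hy2⟩
      by_contra hy
      exact hy2 (h3 y hy1 fun n hn => hy (mem_iUnion.2 ⟨n, hn⟩))
    · refine ⟨fun _ => ∅, fun _ => MeasurableSet.empty, fun _ => smallNull_empty, ?_⟩
      rintro y ⟨h, -⟩
      exact absurd h hne
  refine SNCover.mono ?_ (SNCover.iUnion h)
  rintro x ⟨hx, hx2⟩
  simp only [Dset, mem_iInter, not_forall] at hx
  obtain ⟨q, hq1, hq2⟩ := hx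
  exact mem_iUnion.2 ⟨q, hq1, hq2, hx2⟩

lemma closed_cover (hR : IsReflexiveSpace X) {C : Set X} (hC : IsClosed C) (hcv : Convex ℝ C)
    (hempt : interior C = ∅) : SNCover C := by
  refine SNCover.mono (F := ⋃ k : ℕ, C ∩ Metric.closedBall 0 k) ?_ (SNCover.of_family _ ?_ ?_)
  · intro x hx
    obtain ⟨k, hk⟩ := exists_nat_ge ‖x‖
    exact mem_iUnion.2 ⟨k, hx, mem_closedBall_zero_iff.2 hk⟩
  · intro k
    exact (hC.inter Metric.isClosed_closedBall).measurableSet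
  · intro k
    refine lemma_H hR (M := k) (hC.inter Metric.isClosed_closedBall) (hcv.inter (convex_closedBall 0 _))
      (fun x hx => mem_closedBall_zero_iff.1 hx.2) ?_
    exact subset_empty_iff.1 ((interior_mono inter_subset_left).trans hempt.subset)

lemma dense_part (f : X → ℝ) (hq : QuasiconvexFun f) (hd : DenselyContinuous f) :
    Dense {x : X | ContinuousAt f x ∧ EssGateauxDiffAt f x} := by
  rw [dense_iff_inter_open]
  intro O hO hne
  by_cases hOD : (O \ Dset f).Nonempty
  · obtain ⟨B, h1, h2, h3⟩ := outer_cover hq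
    obtain ⟨u, hu, huB⟩ := SmallNull.not_open (combine_smallNull B h1 h2) (hO.sdiff (Dset_closed f)) hOD
    refine ⟨u, hu.1, ?_⟩
    by_contra hcon
    exact huB (h3 ⟨hu.2, hcon⟩)
  · have hsub : O ⊆ interior (Dset f) := by
      refine interior_maximal ?_ hO
      intro x hx
      by_contra hxD
      exact hOD ⟨x, hx, hxD⟩
    obtain ⟨x0, hx0, hc0⟩ := hd.inter_open_nonempty O hO hne
    have hF : ∀ c < f x0, interior (closure {x | f x < c}) = ∅ := fun c hc => Fn_int hq hd (hsub hx0) hc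
    have hdense : Dense (⋂ n : ℕ, (closure {x | f x < f x0 - 1 / ((n:ℝ) + 1)})ᶜ) := by
      refine dense_iInter_of_isOpen (fun n => isClosed_closure.isOpen_compl) fun n => ?_
      rw [← interior_eq_empty_iff_dense_compl]
      refine hF _ ?_
      have : 0 < 1 / ((n:ℝ) + 1) := by positivity
      linarith
    obtain ⟨x, hx, hxF⟩ := hdense.inter_open_nonempty O hO hne
    refine ⟨x, hx, ?_⟩
    exact inner_thm hq (hsub hx) (fun y hy => int_le hq hc0 hy) hF fun n => mem_iInter.1 hxF n

lemma reflexive_part (f : X → ℝ) (hq : QuasiconvexFun f) (hd : DenselyContinuous f)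
    (hR : IsReflexiveSpace X) : HaarNull {x : X | ¬ (ContinuousAt f x ∧ EssGateauxDiffAt f x)} := by
  apply SNCover.haarNull
  by_cases hne : (interior (Dset f)).Nonempty
  · obtain ⟨x0, hx0, hc0⟩ := hd.inter_open_nonempty _ isOpen_interior hne
    have hF : ∀ c < f x0, interior (closure {x | f x < c}) = ∅ := fun c hc => Fn_int hq hd hx0 hc
    obtain ⟨B, h1, h2, h3⟩ := frontier_thm (Dset_closed f) (Dset_convex hq) hne
    have hin : SNCover (⋃ n : ℕ, closure {x | f x < f x0 - 1 / ((n:ℝ) + 1)}) := by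
      refine SNCover.iUnion fun n => closed_cover hR isClosed_closure (qc_convex hq _).closure (hF _ ?_)
      have : 0 < 1 / ((n:ℝ) + 1) := by positivity
      linarith
    refine SNCover.mono ?_ (((outer_cover hq).union (SNCover.of_family B h1 fun n => (h2 n).smallNull (h1 n))).union hin)
    intro x hx
    by_cases hxD : x ∈ Dset f
    · by_cases hxi : x ∈ interior (Dset f)
      · right
        by_contra hxF
        simp only [mem_iUnion, not_exists] at hxF
        exact hx (inner_thm hq hxi (fun y hy => int_le hq hc0 hy) hF hxF)
      · left; right
        exact mem_iUnion.2 (h3 x hxD hxi)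
    · left; left
      exact ⟨hxD, hx⟩
  · refine SNCover.mono ?_ ((outer_cover hq).union (closed_cover hR (Dset_closed f) (Dset_convex hq)
      (not_nonempty_iff_eq_empty.1 hne)))
    intro x hx
    by_cases hxD : x ∈ Dset f
    · exact Or.inr hxD
    · exact Or.inl ⟨hxD, hx⟩

end finalI

/-- A densely continuous quasiconvex function on a separable Banach space is continuous
and essentially Gâteaux differentiable on a dense set; if `X` is reflexive, the
exceptional set is contained in a Haar null set. -/
theorem stmt_19 {X : Type*} [NormedAddCommGroup X] [NormedSpace ℝ X] [CompleteSpace X]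
    [TopologicalSpace.SeparableSpace X] [MeasurableSpace X] [BorelSpace X]
    (f : X → ℝ) (hq : QuasiconvexFun f) (hd : DenselyContinuous f) :
    Dense {x : X | ContinuousAt f x ∧ EssGateauxDiffAt f x} ∧
    (IsReflexiveSpace X →
      HaarNull {x : X | ¬ (ContinuousAt f x ∧ EssGateauxDiffAt f x)}) := by
  exact ⟨dense_part f hq hd, fun hR => reflexive_part f hq hd hR⟩
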